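/- Let k > 1 and let M ⊆ ℂ^{3k-1} be a 2k-dimensional smooth compact connected submanifold that is totally real except on a finite set S of generic CR-singularities. If M is rationally convex, then there exists a smooth function φ : ℂ^{3k-1} → ℝ that is plurisubharmonic on ℂ^{3k-1} and strictly plurisubharmonic on ℂ^{3k-1} \ S, such that M is isotropic with respect to dd^cφ, i.e., for every p ∈ M and all u, v ∈ T_pM one has D²φ(p)(u, iv) − D²φ(p)(v, iu) = 0, where D²φ(p) denotes the second real Fréchet derivative of φ at p. -/

import Mathlib

open scoped Manifold ComplexConjugate

noncomputable section

/-- Evaluation of a holomorphic polynomial on `ℂ^n`. -/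
def evalPoly {n : ℕ} (P : MvPolynomial (Fin n) ℂ) (z : EuclideanSpace ℂ (Fin n)) : ℂ :=
  MvPolynomial.eval (fun i => z i) P

/-- The polynomially convex hull of a set `K ⊆ ℂ^n`. -/
def polyHull {n : ℕ} (K : Set (EuclideanSpace ℂ (Fin n))) : Set (EuclideanSpace ℂ (Fin n)) :=
  {z | ∀ P : MvPolynomial (Fin n) ℂ, ‖evalPoly P z‖ ≤ ⨆ w ∈ K, ‖evalPoly P w‖}

/-- A set is polynomially convex if it coincides with its polynomially convex hull. -/
def IsPolyConvex {n : ℕ} (K : Set (EuclideanSpace ℂ (Fin n))) : Prop := polyHull K = K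

/-- The rationally convex hull of a set `K ⊆ ℂ^n`. -/
def ratHull {n : ℕ} (K : Set (EuclideanSpace ℂ (Fin n))) : Set (EuclideanSpace ℂ (Fin n)) :=
  {z | ∀ P : MvPolynomial (Fin n) ℂ, evalPoly P z = 0 → ∃ w ∈ K, evalPoly P w = 0}

/-- The closed half-space `{x ∈ ℝ^d : x₀ ≥ 0}`. -/
def halfSpace (d : ℕ) (hd : 0 < d) : Set (EuclideanSpace ℝ (Fin d)) :=
  {x | 0 ≤ x ⟨0, hd⟩}

/-- `M ⊆ ℂ^n` is a `d`-dimensional smooth compact submanifold (possibly with boundary):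
every point admits a smooth local parametrization by a relatively open subset of the closed
half-space `H ⊆ ℝ^d`, which is an immersion and a homeomorphism onto a relatively open
subset of `M`. (Charts with image in the open half-space cover interior points, so closed
submanifolds are included.) -/
def IsSubmanifold {n : ℕ} (d : ℕ) (hd : 0 < d) (M : Set (EuclideanSpace ℂ (Fin n))) : Prop :=
  ∀ p ∈ M, ∃ (V : Set (EuclideanSpace ℝ (Fin d))) (U : Set (EuclideanSpace ℂ (Fin n)))
    (f : EuclideanSpace ℝ (Fin d) → EuclideanSpace ℂ (Fin n)),
    IsOpen V ∧ IsOpen U ∧ p ∈ U ∧ ContDiffOn ℝ (⊤ : ℕ∞) f V ∧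
    Set.InjOn f (V ∩ halfSpace d hd) ∧
    (∀ x ∈ V, Function.Injective (fderiv ℝ f x)) ∧
    f '' (V ∩ halfSpace d hd) = M ∩ U ∧
    (∀ W, IsOpen W → W ⊆ V → ∃ U', IsOpen U' ∧ f '' (W ∩ halfSpace d hd) = M ∩ U')

/-- `p` is a boundary point of the submanifold `M`: some local parametrization as above
maps a point on the boundary of the half-space to `p`. -/
def IsBoundaryPoint {n : ℕ} (d : ℕ) (hd : 0 < d) (M : Set (EuclideanSpace ℂ (Fin n)))
    (p : EuclideanSpace ℂ (Fin n)) : Prop :=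
  p ∈ M ∧ ∃ (V : Set (EuclideanSpace ℝ (Fin d))) (U : Set (EuclideanSpace ℂ (Fin n)))
    (f : EuclideanSpace ℝ (Fin d) → EuclideanSpace ℂ (Fin n)),
    IsOpen V ∧ IsOpen U ∧ p ∈ U ∧ ContDiffOn ℝ (⊤ : ℕ∞) f V ∧
    Set.InjOn f (V ∩ halfSpace d hd) ∧
    (∀ x ∈ V, Function.Injective (fderiv ℝ f x)) ∧
    f '' (V ∩ halfSpace d hd) = M ∩ U ∧
    (∀ W, IsOpen W → W ⊆ V → ∃ U', IsOpen U' ∧ f '' (W ∩ halfSpace d hd) = M ∩ U') ∧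
    ∃ x ∈ V ∩ halfSpace d hd, f x = p ∧ x ⟨0, hd⟩ = 0

/-- The tangent space of `M ⊆ ℂ^n` at `p`, as a real subspace of `ℂ^n`. -/
def tangentSpaceAt {n : ℕ} (M : Set (EuclideanSpace ℂ (Fin n)))
    (p : EuclideanSpace ℂ (Fin n)) : Submodule ℝ (EuclideanSpace ℂ (Fin n)) :=
  Submodule.span ℝ (tangentConeAt ℝ M p)

/-- `M` is totally real at `p`: `T_pM ∩ i·T_pM = {0}`. -/
def TotallyRealAt {n : ℕ} (M : Set (EuclideanSpace ℂ (Fin n)))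
    (p : EuclideanSpace ℂ (Fin n)) : Prop :=
  ∀ v ∈ tangentSpaceAt M p, Complex.I • v ∈ tangentSpaceAt M p → v = (0 : EuclideanSpace ℂ (Fin n))

/-- The Beloshapka–Coffman normal form `𝓜_k ⊆ ℂ^{3k-1}`, in coordinates
`Z = (z, w₁, …, w_{2k-2}, ζ₁, …, ζ_k)`, `w_τ = u_τ + i v_τ`. -/
def bcForm (k : ℕ) (hk : 1 < k) : Set (EuclideanSpace ℂ (Fin (3*k-1))) :=
  {Z | (∀ τ : ℕ, ∀ _h1 : 1 ≤ τ, ∀ _h2 : τ ≤ 2*k-2, (Z ⟨τ, by omega⟩).im = 0) ∧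
    Z ⟨2*k-1, by omega⟩ = (Complex.normSq (Z ⟨0, by omega⟩) : ℂ) +
      conj (Z ⟨0, by omega⟩) * (((Z ⟨1, by omega⟩).re : ℂ) + Complex.I * ((Z ⟨2, by omega⟩).re : ℂ)) ∧
    (∀ σ : ℕ, ∀ _h1 : 2 ≤ σ, ∀ _h2 : σ ≤ k-1,
      Z ⟨2*k-2+σ, by omega⟩ = conj (Z ⟨0, by omega⟩) *
        (((Z ⟨2*σ-1, by omega⟩).re : ℂ) + Complex.I * ((Z ⟨2*σ, by omega⟩).re : ℂ))) ∧
    Z ⟨3*k-2, by omega⟩ = (conj (Z ⟨0, by omega⟩))^2}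

/-- `p` is a generic CR-singularity of `M ⊆ ℂ^{3k-1}`: `(M, p)` is locally biholomorphic
to `(𝓜_k, O)`. -/
def IsGenericCRSingularity (k : ℕ) (hk : 1 < k) (M : Set (EuclideanSpace ℂ (Fin (3*k-1))))
    (p : EuclideanSpace ℂ (Fin (3*k-1))) : Prop :=
  ∃ (U V : Set (EuclideanSpace ℂ (Fin (3*k-1))))
    (Φ Ψ : EuclideanSpace ℂ (Fin (3*k-1)) → EuclideanSpace ℂ (Fin (3*k-1))),
    IsOpen U ∧ IsOpen V ∧ p ∈ U ∧ (0 : EuclideanSpace ℂ (Fin (3*k-1))) ∈ V ∧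
    DifferentiableOn ℂ Φ U ∧ DifferentiableOn ℂ Ψ V ∧
    Set.MapsTo Φ U V ∧ Set.MapsTo Ψ V U ∧
    (∀ x ∈ U, Ψ (Φ x) = x) ∧ (∀ y ∈ V, Φ (Ψ y) = y) ∧
    Φ p = 0 ∧ Φ '' (M ∩ U) = bcForm k hk ∩ V

/-- The Laplacian at `0` of the slice function `λ ↦ ρ(p + λ·v)`. -/
def sliceLaplacian {n : ℕ} (ρ : EuclideanSpace ℂ (Fin n) → ℝ)
    (p v : EuclideanSpace ℂ (Fin n)) : ℝ :=
  iteratedFDeriv ℝ 2 (fun lam : ℂ => ρ (p + lam • v)) 0 ![1, 1]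
  + iteratedFDeriv ℝ 2 (fun lam : ℂ => ρ (p + lam • v)) 0 ![Complex.I, Complex.I]

/-- `ρ` is plurisubharmonic on `U`. -/
def PshOn {n : ℕ} (ρ : EuclideanSpace ℂ (Fin n) → ℝ) (U : Set (EuclideanSpace ℂ (Fin n))) : Prop :=
  ∀ p ∈ U, ∀ v : EuclideanSpace ℂ (Fin n), 0 ≤ sliceLaplacian ρ p v

/-- `ρ` is strictly plurisubharmonic at `p`. -/
def StrictPshAt {n : ℕ} (ρ : EuclideanSpace ℂ (Fin n) → ℝ)
    (p : EuclideanSpace ℂ (Fin n)) : Prop :=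
  ∀ v : EuclideanSpace ℂ (Fin n), v ≠ 0 → 0 < sliceLaplacian ρ p v

/-- `ρ` is strictly plurisubharmonic on a set. -/
def StrictPshOn {n : ℕ} (ρ : EuclideanSpace ℂ (Fin n) → ℝ)
    (U : Set (EuclideanSpace ℂ (Fin n))) : Prop :=
  ∀ p ∈ U, StrictPshAt ρ p

section SecondDerivatives

open Filter Topology

variable {E : Type*} [NormedAddCommGroup E] [NormedSpace ℝ E]

lemma fderiv_fderiv_self_eq_deriv_deriv {h : E → ℝ} {p : E} (hh : ContDiffAt ℝ 2 h p) (w : E) :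
    fderiv ℝ (fderiv ℝ h) p w w = deriv (deriv (fun t : ℝ => h (p + t • w))) 0 := by
  have hline : ∀ t : ℝ, HasDerivAt (fun t : ℝ => p + t • w) w t := fun t => by
    simpa using ((hasDerivAt_id t).smul_const w).const_add p
  have hcont : Tendsto (fun t : ℝ => p + t • w) (𝓝 0) (𝓝 p) := by
    simpa using (hline 0).continuousAt.tendsto
  have hev : ∀ᶠ x in 𝓝 p, DifferentiableAt ℝ h x :=
    (hh.eventually (by simp)).mono fun x hx => hx.differentiableAt (by simp)
  have h1 : deriv (fun t : ℝ => h (p + t • w)) =ᶠ[𝓝 0] fun t => fderiv ℝ h (p + t • w) w :=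
    (hcont.eventually hev).mono fun t ht => (ht.hasFDerivAt.comp_hasDerivAt t (hline t)).deriv
  have h2 : HasFDerivAt (fderiv ℝ h) (fderiv ℝ (fderiv ℝ h) p) (p + (0 : ℝ) • w) := by
    rw [zero_smul, add_zero]
    exact ((hh.fderiv_right (m := 1) (by norm_num)).differentiableAt (by simp)).hasFDerivAt
  have h3 : HasDerivAt (fun t : ℝ => fderiv ℝ h (p + t • w)) (fderiv ℝ (fderiv ℝ h) p w) 0 :=
    h2.comp_hasDerivAt (0 : ℝ) (hline 0)
  have h4 := h3.clm_apply (hasDerivAt_const (0 : ℝ) w)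
  rw [h1.deriv_eq, h4.deriv, map_zero, add_zero]

lemma fderiv_fderiv_self_nonneg_of_isLocalMin {h : E → ℝ} {p : E} (hh : ContDiffAt ℝ 2 h p)
    (hmin : IsLocalMin h p) (w : E) : 0 ≤ fderiv ℝ (fderiv ℝ h) p w w := by
  rw [fderiv_fderiv_self_eq_deriv_deriv hh]
  by_contra! hneg
  have hline : ContDiff ℝ 2 (fun t : ℝ => p + t • w) := by fun_prop
  have hg : ContDiffAt ℝ 2 (fun t : ℝ => h (p + t • w)) 0 :=
    ContDiffAt.comp (0 : ℝ) (by simpa using hh) hline.contDiffAt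
  have hmin' : IsLocalMin (fun t : ℝ => h (p + t • w)) 0 :=
    IsMinFilter.comp_tendsto (g := fun t : ℝ => p + t • w) (by simpa [IsLocalMin] using hmin)
      (by simpa using hline.continuous.tendsto 0)
  have hmax := isLocalMax_of_deriv_deriv_neg hneg hmin'.deriv_eq_zero hg.continuousAt
  have hconst : (fun t : ℝ => h (p + t • w)) =ᶠ[𝓝 0] fun _ => h (p + (0 : ℝ) • w) := by
    filter_upwards [hmin', hmax] with t h1 h2 using le_antisymm h2 h1
  have hd : deriv (fun t : ℝ => h (p + t • w)) =ᶠ[𝓝 0] fun _ => 0 := by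
    simpa using hconst.deriv
  rw [hd.deriv_eq] at hneg
  simp at hneg

end SecondDerivatives

section SliceLaplacian

open Filter Topology

/-- `h` is twice continuously differentiable at `0` and its Laplacian there equals `l`. -/
def HasLaplacianAtZero (h : ℂ → ℝ) (l : ℝ) : Prop :=
  ContDiffAt ℝ 2 h 0 ∧ iteratedFDeriv ℝ 2 h 0 ![1, 1]
    + iteratedFDeriv ℝ 2 h 0 ![Complex.I, Complex.I] = l

lemma hasLaplacianAtZero_iff {h : ℂ → ℝ} {l : ℝ} : HasLaplacianAtZero h l ↔
    ContDiffAt ℝ 2 h 0 ∧ deriv (deriv (fun t : ℝ => h (t • (1 : ℂ)))) 0 +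
      deriv (deriv (fun t : ℝ => h (t • Complex.I))) 0 = l := by
  refine and_congr_right fun hh => ?_
  simp only [iteratedFDeriv_two_apply, Matrix.cons_val_zero, Matrix.cons_val_one]
  rw [fderiv_fderiv_self_eq_deriv_deriv hh, fderiv_fderiv_self_eq_deriv_deriv hh]
  simp

namespace HasLaplacianAtZero

variable {f g : ℂ → ℝ} {l m : ℝ}

lemma congr_of_eventuallyEq (hf : HasLaplacianAtZero f l) (h : g =ᶠ[𝓝 0] f) :
    HasLaplacianAtZero g l := by
  refine ⟨hf.1.congr_of_eventuallyEq h, ?_⟩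
  rw [← hf.2, (h.iteratedFDeriv ℝ 2).self_of_nhds]

lemma add (hf : HasLaplacianAtZero f l) (hg : HasLaplacianAtZero g m) :
    HasLaplacianAtZero (fun x => f x + g x) (l + m) := by
  refine ⟨hf.1.add hg.1, ?_⟩
  have : (fun x => f x + g x) = f + g := rfl
  rw [this, iteratedFDeriv_add_apply hf.1 hg.1, ← hf.2, ← hg.2]
  simp only [add_apply]
  ring

lemma const_mul (c : ℝ) (hf : HasLaplacianAtZero f l) :
    HasLaplacianAtZero (fun x => c * f x) (c * l) := by
  refine ⟨contDiffAt_const.mul hf.1, ?_⟩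
  have : (fun x => c * f x) = c • f := rfl
  rw [this, iteratedFDeriv_const_smul_apply hf.1, ← hf.2]
  simp [mul_add]

lemma sum {ι : Type*} {s : Finset ι} {f : ι → ℂ → ℝ} {l : ι → ℝ}
    (hf : ∀ i ∈ s, HasLaplacianAtZero (f i) (l i)) :
    HasLaplacianAtZero (fun x => ∑ i ∈ s, f i x) (∑ i ∈ s, l i) := by
  classical
  induction s using Finset.induction_on with
  | empty =>
    refine ⟨by simpa using contDiffAt_const, ?_⟩
    simp
  | insert a s ha ih =>
    simp only [Finset.sum_insert ha]
    exact (hf a (by simp)).add (ih fun i hi => hf i (by simp [hi]))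

end HasLaplacianAtZero

lemma hasDerivAt_re_mul_conj {a b : ℝ → ℂ} {a' b' : ℂ} {t : ℝ} (ha : HasDerivAt a a' t)
    (hb : HasDerivAt b b' t) :
    HasDerivAt (fun t => (a t * conj (b t)).re) (a' * conj (b t) + a t * conj b').re t :=
  Complex.reCLM.hasFDerivAt.comp_hasDerivAt t (ha.mul hb.star)

lemma hasDerivAt_comp_smul {a : ℂ → ℂ} {a' : ℂ} (w : ℂ) {t : ℝ} (ha : HasDerivAt a a' (t • w)) :
    HasDerivAt (fun t : ℝ => a (t • w)) (a' * w) t := by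
  have h : HasDerivAt (fun t : ℝ => t • w) w t := by
    simpa using (hasDerivAt_id t).smul_const w
  rw [mul_comm]
  exact ha.scomp t h

lemma deriv_deriv_re_mul_conj {a b : ℂ → ℂ} (ha : AnalyticAt ℂ a 0) (hb : AnalyticAt ℂ b 0)
    (w : ℂ) : deriv (deriv (fun t : ℝ => (a (t • w) * conj (b (t • w))).re)) 0 =
      (deriv (deriv a) 0 * w ^ 2 * conj (b 0) + 2 * (deriv a 0 * w * conj (deriv b 0 * w))
        + a 0 * conj (deriv (deriv b) 0 * w ^ 2)).re := by
  have hcont : Tendsto (fun t : ℝ => t • w) (𝓝 0) (𝓝 0) := by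
    have : Continuous fun t : ℝ => t • w := by fun_prop
    simpa using this.tendsto 0
  have h1 : deriv (fun t : ℝ => (a (t • w) * conj (b (t • w))).re) =ᶠ[𝓝 0]
      fun t : ℝ => ((deriv a (t • w) * w) * conj (b (t • w))).re
        + (a (t • w) * conj (deriv b (t • w) * w)).re := by
    filter_upwards [hcont.eventually ha.eventually_analyticAt,
      hcont.eventually hb.eventually_analyticAt] with t h2 h3
    rw [(hasDerivAt_re_mul_conj (hasDerivAt_comp_smul w h2.differentiableAt.hasDerivAt)
      (hasDerivAt_comp_smul w h3.differentiableAt.hasDerivAt)).deriv, Complex.add_re]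
  rw [h1.deriv_eq]
  have z0 : (0 : ℝ) • w = 0 := zero_smul ℝ w
  have ha0 := hasDerivAt_comp_smul w (t := 0) (z0 ▸ ha.differentiableAt.hasDerivAt)
  have hb0 := hasDerivAt_comp_smul w (t := 0) (z0 ▸ hb.differentiableAt.hasDerivAt)
  have ha1 := hasDerivAt_comp_smul w (t := 0) (z0 ▸ ha.deriv.differentiableAt.hasDerivAt)
  have hb1 := hasDerivAt_comp_smul w (t := 0) (z0 ▸ hb.deriv.differentiableAt.hasDerivAt)
  have := (hasDerivAt_re_mul_conj (ha1.mul_const w) hb0).add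
    (hasDerivAt_re_mul_conj ha0 (hb1.mul_const w))
  refine this.deriv.trans ?_
  rw [← Complex.add_re, z0]
  congr 1
  simp only [map_mul, map_pow]
  ring

lemma hasLaplacianAtZero_re_mul_conj {a b : ℂ → ℂ} (ha : AnalyticAt ℂ a 0)
    (hb : AnalyticAt ℂ b 0) :
    HasLaplacianAtZero (fun x => (a x * conj (b x)).re) (4 * (deriv a 0 * conj (deriv b 0)).re) := by
  rw [hasLaplacianAtZero_iff]
  refine ⟨?_, ?_⟩
  · have ha2 : ContDiffAt ℝ 2 a 0 := ha.contDiffAt.restrict_scalars ℝ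
    have hb2 : ContDiffAt ℝ 2 b 0 := hb.contDiffAt.restrict_scalars ℝ
    exact Complex.reCLM.contDiff.contDiffAt.comp 0
      (ha2.mul (Complex.conjCLE.contDiff.contDiffAt.comp 0 hb2))
  · rw [deriv_deriv_re_mul_conj ha hb, deriv_deriv_re_mul_conj ha hb]
    simp
    ring

lemma HasLaplacianAtZero.comp {u : ℂ → ℝ} {l : ℝ} {G : ℝ → ℝ} (hu : HasLaplacianAtZero u l)
    (hG : ContDiff ℝ 2 G) :
    HasLaplacianAtZero (fun x => G (u x)) (deriv G (u 0) * l + deriv (deriv G) (u 0) *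
      (fderiv ℝ u 0 1 ^ 2 + fderiv ℝ u 0 Complex.I ^ 2)) := by
  have key : ∀ w : ℂ, deriv (deriv (fun t : ℝ => G (u (t • w)))) 0 =
      deriv G (u 0) * deriv (deriv (fun t : ℝ => u (t • w))) 0 +
        deriv (deriv G) (u 0) * fderiv ℝ u 0 w ^ 2 := by
    intro w
    have hl : ContDiff ℝ 2 (fun t : ℝ => t • w) := by fun_prop
    have hv : ContDiffAt ℝ 2 (fun t : ℝ => u (t • w)) 0 :=
      ContDiffAt.comp (0 : ℝ) (by simpa using hu.1) hl.contDiffAt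
    have hG1 : Differentiable ℝ G := hG.differentiable (by simp)
    have hG2 : Differentiable ℝ (deriv G) :=
      (contDiff_succ_iff_deriv.1 (show ContDiff ℝ (1 + 1) G by
        simpa [one_add_one_eq_two] using hG)).2.2.differentiable (by simp)
    have h1 : deriv (fun t : ℝ => G (u (t • w))) =ᶠ[𝓝 0]
        fun t => deriv G (u (t • w)) * deriv (fun t : ℝ => u (t • w)) t := by
      filter_upwards [hv.eventually (by simp)] with t ht
      exact ((hG1 _).hasDerivAt.comp t (ht.differentiableAt (by simp)).hasDerivAt).deriv
    have hv1 : DifferentiableAt ℝ (deriv (fun t : ℝ => u (t • w))) 0 :=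
      ((hv.fderiv_right (m := 1) (by norm_num)).differentiableAt (by simp)).clm_apply
        (differentiableAt_const (1 : ℝ))
    have hv0 : deriv (fun t : ℝ => u (t • w)) 0 = fderiv ℝ u 0 w := by
      have hd : HasDerivAt (fun t : ℝ => t • w) w 0 := by
        simpa using (hasDerivAt_id (0 : ℝ)).smul_const w
      have hu1 : HasFDerivAt u (fderiv ℝ u 0) ((0 : ℝ) • w) := by
        simpa using (hu.1.differentiableAt (by simp)).hasFDerivAt
      exact (hu1.comp_hasDerivAt (0 : ℝ) hd).deriv
    rw [h1.deriv_eq]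
    have := ((hG2 (u ((0 : ℝ) • w))).hasDerivAt.comp (0 : ℝ)
      (hv.differentiableAt (by simp)).hasDerivAt).mul hv1.hasDerivAt
    refine this.deriv.trans ?_
    simp only [Function.comp_apply, hv0, zero_smul]
    ring
  rw [hasLaplacianAtZero_iff] at hu ⊢
  refine ⟨hG.contDiffAt.comp 0 hu.1, ?_⟩
  rw [key, key, ← hu.2]
  ring

end SliceLaplacian

section Levi

open Filter Topology

variable {n : ℕ} {φ ψ : EuclideanSpace ℂ (Fin n) → ℝ} {p v : EuclideanSpace ℂ (Fin n)}

lemma contDiffAt_slice (hφ : ContDiffAt ℝ 2 φ p) (v : EuclideanSpace ℂ (Fin n)) :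
    ContDiffAt ℝ 2 (fun lam : ℂ => φ (p + lam • v)) 0 := by
  have : ContDiff ℝ 2 (fun lam : ℂ => p + lam • v) := by fun_prop
  exact ContDiffAt.comp (0 : ℂ) (by simpa using hφ) this.contDiffAt

lemma hasLaplacianAtZero_slice (hφ : ContDiffAt ℝ 2 φ p) (v : EuclideanSpace ℂ (Fin n)) :
    HasLaplacianAtZero (fun lam : ℂ => φ (p + lam • v)) (sliceLaplacian φ p v) :=
  ⟨contDiffAt_slice hφ v, rfl⟩

lemma sliceLaplacian_eq (hφ : ContDiffAt ℝ 2 φ p) (v : EuclideanSpace ℂ (Fin n)) :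
    sliceLaplacian φ p v = fderiv ℝ (fderiv ℝ φ) p v v
      + fderiv ℝ (fderiv ℝ φ) p (Complex.I • v) (Complex.I • v) := by
  rw [← (hasLaplacianAtZero_iff.1 (hasLaplacianAtZero_slice hφ v)).2,
    fderiv_fderiv_self_eq_deriv_deriv hφ, fderiv_fderiv_self_eq_deriv_deriv hφ]
  simp only [smul_assoc, one_smul]

lemma sliceLaplacian_add (hφ : ContDiffAt ℝ 2 φ p) (hψ : ContDiffAt ℝ 2 ψ p)
    (v : EuclideanSpace ℂ (Fin n)) :
    sliceLaplacian (fun x => φ x + ψ x) p v = sliceLaplacian φ p v + sliceLaplacian ψ p v :=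
  ((hasLaplacianAtZero_slice hφ v).add (hasLaplacianAtZero_slice hψ v)).2

lemma sliceLaplacian_const_mul (c : ℝ) (hφ : ContDiffAt ℝ 2 φ p)
    (v : EuclideanSpace ℂ (Fin n)) :
    sliceLaplacian (fun x => c * φ x) p v = c * sliceLaplacian φ p v :=
  ((hasLaplacianAtZero_slice hφ v).const_mul c).2

lemma sliceLaplacian_sum {ι : Type*} {s : Finset ι} {f : ι → EuclideanSpace ℂ (Fin n) → ℝ}
    (hf : ∀ i ∈ s, ContDiffAt ℝ 2 (f i) p) (v : EuclideanSpace ℂ (Fin n)) :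
    sliceLaplacian (fun x => ∑ i ∈ s, f i x) p v = ∑ i ∈ s, sliceLaplacian (f i) p v :=
  (HasLaplacianAtZero.sum fun i hi => hasLaplacianAtZero_slice (hf i hi) v).2

lemma sliceLaplacian_congr (h : φ =ᶠ[𝓝 p] ψ) (v : EuclideanSpace ℂ (Fin n)) :
    sliceLaplacian φ p v = sliceLaplacian ψ p v := by
  have hc : Tendsto (fun lam : ℂ => p + lam • v) (𝓝 0) (𝓝 p) := by
    have : Continuous fun lam : ℂ => p + lam • v := by fun_prop
    simpa using this.tendsto 0
  have h' : (fun lam : ℂ => φ (p + lam • v)) =ᶠ[𝓝 0] fun lam => ψ (p + lam • v) :=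
    hc.eventually h
  rw [sliceLaplacian, sliceLaplacian, (h'.iteratedFDeriv ℝ 2).self_of_nhds]

lemma sliceLaplacian_smul (hφ : ContDiffAt ℝ 2 φ p) (t : ℝ) (v : EuclideanSpace ℂ (Fin n)) :
    sliceLaplacian φ p (t • v) = t ^ 2 * sliceLaplacian φ p v := by
  rw [sliceLaplacian_eq hφ, sliceLaplacian_eq hφ, smul_comm Complex.I t v]
  simp only [map_smul, smul_apply, smul_eq_mul]
  ring

lemma sliceLaplacian_nonneg_of_isLocalMin (hφ : ContDiffAt ℝ 2 φ p) (hmin : IsLocalMin φ p)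
    (v : EuclideanSpace ℂ (Fin n)) : 0 ≤ sliceLaplacian φ p v := by
  rw [sliceLaplacian_eq hφ]
  exact add_nonneg (fderiv_fderiv_self_nonneg_of_isLocalMin hφ hmin _)
    (fderiv_fderiv_self_nonneg_of_isLocalMin hφ hmin _)

lemma continuous_sliceLaplacian (hφ : ContDiff ℝ 2 φ) :
    Continuous fun q : EuclideanSpace ℂ (Fin n) × EuclideanSpace ℂ (Fin n) =>
      sliceLaplacian φ q.1 q.2 := by
  have h2 : Continuous (fderiv ℝ (fderiv ℝ φ)) :=
    (hφ.fderiv_right (m := 1) (by norm_num)).continuous_fderiv (by simp)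
  have h3 : (fun q : EuclideanSpace ℂ (Fin n) × EuclideanSpace ℂ (Fin n) =>
      sliceLaplacian φ q.1 q.2) = fun q => fderiv ℝ (fderiv ℝ φ) q.1 q.2 q.2
      + fderiv ℝ (fderiv ℝ φ) q.1 (Complex.I • q.2) (Complex.I • q.2) :=
    funext fun q => sliceLaplacian_eq hφ.contDiffAt q.2
  rw [h3]
  have h4 := h2.comp (continuous_fst (X := EuclideanSpace ℂ (Fin n))
    (Y := EuclideanSpace ℂ (Fin n)))
  have h5 : Continuous fun q : EuclideanSpace ℂ (Fin n) × EuclideanSpace ℂ (Fin n) =>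
    Complex.I • q.2 := by fun_prop
  exact ((h4.clm_apply continuous_snd).clm_apply continuous_snd).add
    ((h4.clm_apply h5).clm_apply h5)

lemma strictPshAt_of_sphere (hφ : ContDiffAt ℝ 2 φ p)
    (h : ∀ v ∈ Metric.sphere (0 : EuclideanSpace ℂ (Fin n)) 1, 0 < sliceLaplacian φ p v) :
    StrictPshAt φ p := by
  intro v hv
  have hv' : 0 < ‖v‖ := norm_pos_iff.2 hv
  have h1 : v = ‖v‖ • (‖v‖⁻¹ • v) := by rw [smul_smul, mul_inv_cancel₀ hv'.ne', one_smul]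
  rw [h1, sliceLaplacian_smul hφ]
  refine mul_pos (by positivity) (h _ ?_)
  simp [norm_smul, hv'.ne']

lemma isOpen_setOf_strictPshAt (hφ : ContDiff ℝ 2 φ) : IsOpen {x | StrictPshAt φ x} := by
  rw [isOpen_iff_mem_nhds]
  intro x hx
  have hopen : IsOpen {q : EuclideanSpace ℂ (Fin n) × EuclideanSpace ℂ (Fin n) |
      0 < sliceLaplacian φ q.1 q.2} := isOpen_lt continuous_const (continuous_sliceLaplacian hφ)
  have hsub : {x} ×ˢ Metric.sphere (0 : EuclideanSpace ℂ (Fin n)) 1 ⊆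
      {q : EuclideanSpace ℂ (Fin n) × EuclideanSpace ℂ (Fin n) |
        0 < sliceLaplacian φ q.1 q.2} := by
    rintro ⟨a, b⟩ ⟨ha, hb⟩
    rw [Set.mem_singleton_iff] at ha
    simp only at ha hb
    subst ha
    exact hx b (ne_zero_of_mem_unit_sphere ⟨b, hb⟩)
  obtain ⟨u, w, hu, -, hxu, hw, huw⟩ := generalized_tube_lemma isCompact_singleton
    (isCompact_sphere (0 : EuclideanSpace ℂ (Fin n)) 1) hopen hsub
  refine mem_of_superset (hu.mem_nhds (hxu (Set.mem_singleton x))) fun y hy => ?_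
  refine strictPshAt_of_sphere hφ.contDiffAt fun v hv => ?_
  have hmem : (y, v) ∈ u ×ˢ w := ⟨hy, hw hv⟩
  simpa only [Set.mem_ofPred_eq] using huw hmem

/-- On a compact set a function can be made strictly plurisubharmonic by adding a large multiple
of a strictly plurisubharmonic one. -/
lemma exists_strictPshOn_const_mul_add {K : Set (EuclideanSpace ℂ (Fin n))} (hK : IsCompact K)
    (hφ : ContDiff ℝ 2 φ) (hψ : ContDiff ℝ 2 ψ) (h : StrictPshOn φ K) :
    ∃ C : ℝ, 0 < C ∧ StrictPshOn (fun x => C * φ x + ψ x) K := by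
  have hc := hK.prod (isCompact_sphere (0 : EuclideanSpace ℂ (Fin n)) 1)
  obtain ⟨B, hB⟩ := hc.bddAbove_image
    (((continuous_sliceLaplacian hψ).neg.continuousOn.div (continuous_sliceLaplacian hφ).continuousOn)
      fun q hq => (h q.1 hq.1 q.2 (ne_zero_of_mem_unit_sphere ⟨q.2, hq.2⟩)).ne')
  refine ⟨max B 0 + 1, by positivity, fun x hx => ?_⟩
  have hC : ContDiff ℝ 2 fun x => (max B 0 + 1) * φ x := contDiff_const.mul hφ
  refine strictPshAt_of_sphere (hC.add hψ).contDiffAt fun v hv => ?_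
  rw [sliceLaplacian_add hC.contDiffAt hψ.contDiffAt, sliceLaplacian_const_mul _ hφ.contDiffAt]
  have h1 := h x hx v (ne_zero_of_mem_unit_sphere ⟨v, hv⟩)
  have h2 : -sliceLaplacian ψ x v / sliceLaplacian φ x v ≤ B :=
    hB ⟨(x, v), ⟨hx, hv⟩, rfl⟩
  rw [div_le_iff₀ h1] at h2
  nlinarith [le_max_left B 0]

lemma isotropic_of_sliceLaplacian_eq_zero (hφ : ContDiffAt ℝ 2 φ p)
    (h : ∀ v, sliceLaplacian φ p v = 0) (u v : EuclideanSpace ℂ (Fin n)) :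
    fderiv ℝ (fderiv ℝ φ) p u (Complex.I • v) - fderiv ℝ (fderiv ℝ φ) p v (Complex.I • u) = 0 := by
  have hs : IsSymmSndFDerivAt ℝ φ p := hφ.isSymmSndFDerivAt (by simp)
  have h1 := h (u + Complex.I • v)
  have h2 := h u
  have h3 := h (Complex.I • v)
  have hI : Complex.I • Complex.I • v = -v := by
    rw [smul_smul, Complex.I_mul_I, neg_one_smul]
  rw [sliceLaplacian_eq hφ] at h1 h2 h3
  simp only [smul_add, hI, map_add, map_neg, add_apply,
    neg_apply] at h1 h2 h3
  have e1 := hs.eq u (Complex.I • v)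
  have e2 := hs.eq v (Complex.I • u)
  linarith

lemma fderiv_fderiv_eq_zero_of_mem_tangentSpaceAt {M : Set (EuclideanSpace ℂ (Fin n))}
    (hψ : ContDiff ℝ 2 ψ) (h0 : ∀ x, 0 ≤ ψ x) (hM : ∀ x ∈ M, ψ x = 0) (hp : p ∈ M)
    {u : EuclideanSpace ℂ (Fin n)} (hu : u ∈ tangentSpaceAt M p) :
    fderiv ℝ (fderiv ℝ ψ) p u = 0 := by
  have hd : ∀ x ∈ M, fderiv ℝ ψ x = 0 := fun x hx =>
    IsLocalMin.fderiv_eq_zero (Filter.Eventually.of_forall fun y => by rw [hM x hx]; exact h0 y)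
  have h1 : HasFDerivWithinAt (fderiv ℝ ψ) (fderiv ℝ (fderiv ℝ ψ) p) M p :=
    (((hψ.fderiv_right (m := 1) (by norm_num)).differentiable (by simp)) p).hasFDerivAt.hasFDerivWithinAt
  have h2 : HasFDerivWithinAt (fderiv ℝ ψ)
      (0 : EuclideanSpace ℂ (Fin n) →L[ℝ] EuclideanSpace ℂ (Fin n) →L[ℝ] ℝ) M p :=
    (hasFDerivWithinAt_const (0 : EuclideanSpace ℂ (Fin n) →L[ℝ] ℝ) p M).congr hd (hd p hp)
  have h3 : Set.EqOn (fderiv ℝ (fderiv ℝ ψ) p)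
      (0 : EuclideanSpace ℂ (Fin n) →L[ℝ] EuclideanSpace ℂ (Fin n) →L[ℝ] ℝ)
      (tangentConeAt ℝ M p) := h1.unique_on h2
  have h4 : tangentSpaceAt M p ≤ LinearMap.ker (fderiv ℝ (fderiv ℝ ψ) p).toLinearMap :=
    Submodule.span_le.2 fun x hx => h3 hx
  exact h4 hu

end Levi

section PolynomialPart

open Filter Topology

/-- For `δ > 0` there is a smooth `G` such that `G(|f|²)` is plurisubharmonic for holomorphic `f`,
pluriharmonic where `|f|² ≥ δ`, and strictly subharmonic at simple zeros of `f`. -/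
lemma exists_subharmonic_profile {δ : ℝ} (hδ : 0 < δ) : ∃ G : ℝ → ℝ, ContDiff ℝ (⊤ : ℕ∞) G ∧
    (∀ s, 0 ≤ s → 0 ≤ deriv G s + s * deriv (deriv G) s) ∧
    (∀ s, δ ≤ s → deriv G s + s * deriv (deriv G) s = 0) ∧ 0 < deriv G 0 := by
  set β : ℝ → ℝ := fun s => Real.smoothTransition (2 - 2 * s / δ) with hβ
  set q : ℝ → ℝ := fun s => β s / δ + (1 - β s) / s with hq
  have hβs : ContDiff ℝ (⊤ : ℕ∞) β := Real.smoothTransition.contDiff.comp (by fun_prop)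
  have hβ1 : ∀ s, s ≤ δ / 2 → β s = 1 := fun s hs => by
    refine Real.smoothTransition.one_of_one_le ?_
    have : 2 * s / δ ≤ 1 := by rw [div_le_one hδ]; linarith
    linarith
  have hβ0 : ∀ s, δ ≤ s → β s = 0 := fun s hs => by
    refine Real.smoothTransition.zero_of_nonpos ?_
    have : 2 ≤ 2 * s / δ := by rw [le_div_iff₀ hδ]; linarith
    linarith
  have hβanti : Antitone β := fun a b hab => by
    refine Real.smoothTransition.monotone ?_
    have : 2 * a / δ ≤ 2 * b / δ := by gcongr
    linarith
  have hβd : ∀ s, HasDerivAt β (deriv β s) s := fun s =>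
    ((hβs.differentiable (by simp)) s).hasDerivAt
  have hqs : ContDiff ℝ (⊤ : ℕ∞) q := by
    rw [contDiff_iff_contDiffAt]
    intro s
    rcases lt_or_ge s (δ / 2) with hs | hs
    · refine ((hβs.div_const δ).contDiffAt).congr_of_eventuallyEq ?_
      filter_upwards [Iio_mem_nhds hs] with t ht
      simp [hq, hβ1 t (le_of_lt ht)]
    · exact (hβs.div_const δ).contDiffAt.add ((contDiff_const.sub hβs).contDiffAt.div contDiffAt_id
        (by simpa using (lt_of_lt_of_le (half_pos hδ) hs).ne'))
  set G : ℝ → ℝ := fun s => ∫ t in (0 : ℝ)..s, q t with hG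
  have hGd : ∀ s, HasDerivAt G (q s) s := fun s =>
    (hqs.continuous.integral_hasStrictDerivAt 0 s).hasDerivAt
  have hGd' : deriv G = q := funext fun s => (hGd s).deriv
  have hsq : (fun s => s * q s) = fun s => s * β s / δ + (1 - β s) := by
    funext s
    rcases eq_or_ne s 0 with rfl | hs
    · simp [hβ1 0 (by positivity)]
    · simp only [hq]; field_simp
  have key : ∀ s, deriv G s + s * deriv (deriv G) s = β s / δ + deriv β s * (s / δ - 1) := by
    intro s
    have h1 : HasDerivAt (fun s => s * q s) (1 * q s + s * deriv q s) s :=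
      (hasDerivAt_id s).mul ((hqs.differentiable (by simp)) s).hasDerivAt
    have h2 : HasDerivAt (fun s => s * β s / δ + (1 - β s))
        ((1 * β s + s * deriv β s) / δ + -deriv β s) s :=
      (((hasDerivAt_id s).mul (hβd s)).div_const δ).add ((hβd s).const_sub 1)
    rw [hsq] at h1
    have h3 := h1.unique h2
    rw [hGd']
    rw [one_mul] at h3
    rw [h3]
    field_simp
    ring
  have hzero : ∀ s, δ ≤ s → deriv G s + s * deriv (deriv G) s = 0 := by
    intro s hs
    have hd : deriv β s * (s / δ - 1) = 0 := by
      rcases hs.eq_or_lt with rfl | h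
      · simp [hδ.ne']
      · have : β =ᶠ[𝓝 s] fun _ => 0 := by
          filter_upwards [Ioi_mem_nhds h] with t ht using hβ0 t (le_of_lt ht)
        rw [this.deriv_eq]; simp
    rw [key, hd, hβ0 s hs]; simp
  refine ⟨G, ?_, fun s hs => ?_, hzero, ?_⟩
  · rw [contDiff_infty_iff_deriv, hGd']
    exact ⟨fun s => (hGd s).differentiableAt, hqs⟩
  · rcases le_or_gt δ s with h | h
    · exact (hzero s h).ge
    · rw [key]
      have h1 : deriv β s ≤ 0 := hβanti.deriv_nonpos
      have h2 : s / δ - 1 ≤ 0 := by rw [sub_nonpos, div_le_one hδ]; exact h.le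
      have h3 : 0 ≤ β s := Real.smoothTransition.nonneg _
      have := mul_nonneg_of_nonpos_of_nonpos h1 h2
      positivity
  · rw [hGd']
    simp [hq, hβ1 0 (by positivity), hδ]

lemma hasLaplacianAtZero_comp_normSq {f : ℂ → ℂ} (hf : AnalyticAt ℂ f 0) {G : ℝ → ℝ}
    (hG : ContDiff ℝ 2 G) :
    HasLaplacianAtZero (fun x => G (Complex.normSq (f x)))
      (4 * Complex.normSq (deriv f 0) * (deriv G (Complex.normSq (f 0))
        + Complex.normSq (f 0) * deriv (deriv G) (Complex.normSq (f 0)))) := by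
  have hu : HasLaplacianAtZero (fun x => Complex.normSq (f x))
      (4 * Complex.normSq (deriv f 0)) := by
    have := hasLaplacianAtZero_re_mul_conj hf hf
    simpa only [Complex.mul_conj, Complex.ofReal_re] using this
  have hd : ∀ w : ℂ, fderiv ℝ (fun x => Complex.normSq (f x)) 0 w
      = 2 * (deriv f 0 * w * conj (f 0)).re := by
    intro w
    have hdiff : DifferentiableAt ℝ (fun x => Complex.normSq (f x)) 0 :=
      hu.1.differentiableAt (by simp)
    have h1 : HasDerivAt (fun t : ℝ => t • w) w 0 := by
      simpa using (hasDerivAt_id (0 : ℝ)).smul_const w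
    have h2 : HasDerivAt (fun t : ℝ => Complex.normSq (f (t • w)))
        (fderiv ℝ (fun x => Complex.normSq (f x)) 0 w) 0 :=
      HasFDerivAt.comp_hasDerivAt (l := fun x => Complex.normSq (f x)) (f := fun t : ℝ => t • w)
        (0 : ℝ) (by simpa using hdiff.hasFDerivAt) h1
    have h3 : HasDerivAt (fun t : ℝ => f (t • w)) (deriv f 0 * w) 0 :=
      hasDerivAt_comp_smul w (by simpa using hf.differentiableAt.hasDerivAt)
    have h4 := hasDerivAt_re_mul_conj h3 h3
    simp only [Complex.mul_conj, Complex.ofReal_re] at h4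
    rw [h2.unique h4]
    simp only [zero_smul, Complex.add_re, Complex.mul_re, Complex.conj_re, Complex.conj_im]
    ring
  have := hu.comp hG
  convert this using 1
  rw [hd, hd]
  simp only [Complex.normSq_apply, Complex.mul_re, Complex.mul_im, Complex.conj_re,
    Complex.conj_im, Complex.I_re, Complex.I_im, Complex.one_re, Complex.one_im]
  ring

variable {n : ℕ}

lemma hasDerivAt_slice {f : EuclideanSpace ℂ (Fin n) → ℂ} {p : EuclideanSpace ℂ (Fin n)}
    (hf : DifferentiableAt ℂ f p) (v : EuclideanSpace ℂ (Fin n)) :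
    HasDerivAt (fun lam : ℂ => f (p + lam • v)) (fderiv ℂ f p v) 0 := by
  have h1 : HasDerivAt (fun lam : ℂ => p + lam • v) v 0 := by
    simpa using ((hasDerivAt_id (0 : ℂ)).smul_const v).const_add p
  exact HasFDerivAt.comp_hasDerivAt (f := fun lam : ℂ => p + lam • v) (0 : ℂ)
    (by simpa using hf.hasFDerivAt) h1

lemma analyticAt_slice {f : EuclideanSpace ℂ (Fin n) → ℂ} {p : EuclideanSpace ℂ (Fin n)}
    (hf : ∀ᶠ x in 𝓝 p, DifferentiableAt ℂ f x) (v : EuclideanSpace ℂ (Fin n)) :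
    AnalyticAt ℂ (fun lam : ℂ => f (p + lam • v)) 0 := by
  rw [Complex.analyticAt_iff_eventually_differentiableAt]
  have hc : Tendsto (fun lam : ℂ => p + lam • v) (𝓝 0) (𝓝 p) := by
    have : Continuous fun lam : ℂ => p + lam • v := by fun_prop
    simpa using this.tendsto 0
  filter_upwards [hc.eventually hf] with lam hlam
  exact DifferentiableAt.comp lam hlam (by fun_prop)

lemma sliceLaplacian_comp_normSq {f : EuclideanSpace ℂ (Fin n) → ℂ} (hf : Differentiable ℂ f)
    {G : ℝ → ℝ} (hG : ContDiff ℝ 2 G) (p v : EuclideanSpace ℂ (Fin n)) :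
    sliceLaplacian (fun x => G (Complex.normSq (f x))) p v =
      4 * Complex.normSq (fderiv ℂ f p v) * (deriv G (Complex.normSq (f p))
        + Complex.normSq (f p) * deriv (deriv G) (Complex.normSq (f p))) := by
  have h := hasLaplacianAtZero_comp_normSq (analyticAt_slice (p := p) (.of_forall hf) v) hG
  rw [(hasDerivAt_slice (hf p) v).deriv] at h
  simp only [zero_smul, add_zero] at h
  exact h.2

lemma contDiff_evalPoly (P : MvPolynomial (Fin n) ℂ) {m : WithTop ℕ∞} :
    ContDiff ℂ m (evalPoly P) := by
  induction P using MvPolynomial.induction_on with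
  | C a =>
    have : evalPoly (MvPolynomial.C a : MvPolynomial (Fin n) ℂ) = fun _ => a :=
      funext fun z => by simp [evalPoly]
    rw [this]
    exact contDiff_const
  | add p q hp hq =>
    have : evalPoly (p + q) = fun z => evalPoly p z + evalPoly q z :=
      funext fun z => by simp [evalPoly]
    rw [this]
    exact hp.add hq
  | mul_X p i hp =>
    have h : ContDiff ℂ m fun z : EuclideanSpace ℂ (Fin n) => z i := by fun_prop
    have h' : evalPoly (p * MvPolynomial.X i) = fun z => evalPoly p z * z i :=
      funext fun z => by simp [evalPoly]
    rw [h']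
    exact hp.mul h

lemma contDiff_normSq {m : WithTop ℕ∞} : ContDiff ℝ m Complex.normSq := by
  have : (Complex.normSq : ℂ → ℝ) = fun z => z.re * z.re + z.im * z.im :=
    funext Complex.normSq_apply
  rw [this]
  exact (Complex.reCLM.contDiff.mul Complex.reCLM.contDiff).add
    (Complex.imCLM.contDiff.mul Complex.imCLM.contDiff)

/-- `φ` is smooth and plurisubharmonic on `ℂ^n` with vanishing Levi form on `M`. -/
structure IsPshFlatOn (φ : EuclideanSpace ℂ (Fin n) → ℝ) (M : Set (EuclideanSpace ℂ (Fin n))) :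
    Prop where
  contDiff : ContDiff ℝ (⊤ : ℕ∞) φ
  nonneg : ∀ p v, 0 ≤ sliceLaplacian φ p v
  flat : ∀ p ∈ M, ∀ v, sliceLaplacian φ p v = 0

namespace IsPshFlatOn

variable {M : Set (EuclideanSpace ℂ (Fin n))}

lemma contDiff_two {φ : EuclideanSpace ℂ (Fin n) → ℝ} (h : IsPshFlatOn φ M) : ContDiff ℝ 2 φ :=
  h.contDiff.of_le (WithTop.coe_le_coe.2 le_top)

lemma sum {ι : Type*} {s : Finset ι} {φ : ι → EuclideanSpace ℂ (Fin n) → ℝ}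
    (h : ∀ i ∈ s, IsPshFlatOn (φ i) M) : IsPshFlatOn (fun x => ∑ i ∈ s, φ i x) M where
  contDiff := ContDiff.sum fun i hi => (h i hi).contDiff
  nonneg p v := by
    rw [sliceLaplacian_sum fun i hi => (h i hi).contDiff_two.contDiffAt]
    exact Finset.sum_nonneg fun i hi => (h i hi).nonneg p v
  flat p hp v := by
    rw [sliceLaplacian_sum fun i hi => (h i hi).contDiff_two.contDiffAt]
    exact Finset.sum_eq_zero fun i hi => (h i hi).flat p hp v

end IsPshFlatOn

variable {M : Set (EuclideanSpace ℂ (Fin n))}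

lemma strictPshAt_sum {ι : Type*} {s : Finset ι} {φ : ι → EuclideanSpace ℂ (Fin n) → ℝ}
    {x : EuclideanSpace ℂ (Fin n)} (h : ∀ i ∈ s, ContDiffAt ℝ 2 (φ i) x)
    (h0 : ∀ i ∈ s, ∀ v, 0 ≤ sliceLaplacian (φ i) x v)
    (hx : ∀ v, v ≠ 0 → ∃ i ∈ s, 0 < sliceLaplacian (φ i) x v) :
    StrictPshAt (fun x => ∑ i ∈ s, φ i x) x := by
  intro v hv
  rw [sliceLaplacian_sum h]
  exact Finset.sum_pos' (fun i hi => h0 i hi v) (hx v hv)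

lemma exists_isPshFlatOn_strictPshAt (hM : IsCompact M) (hne : M.Nonempty)
    {x : EuclideanSpace ℂ (Fin n)} (hx : x ∉ ratHull M) :
    ∃ φ, IsPshFlatOn φ M ∧ StrictPshAt φ x := by
  simp only [ratHull, Set.mem_ofPred_eq, not_forall, not_exists, not_and] at hx
  obtain ⟨P, hPx, hPM⟩ := hx
  have hP : ContDiff ℂ (⊤ : ℕ∞) (evalPoly P) := contDiff_evalPoly P
  obtain ⟨y, hy, hmin⟩ := hM.exists_isMinOn hne hP.continuous.norm.continuousOn
  set m := ‖evalPoly P y‖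
  have hm : 0 < m := norm_pos_iff.2 (hPM y hy)
  obtain ⟨B, hB⟩ := hM.bddAbove_image
    (f := fun z => ‖z - x‖) (by fun_prop)
  have hB' : ∀ z ∈ M, ‖z - x‖ ≤ B := fun z hz => hB ⟨z, hz, rfl⟩
  have hB0 : 0 ≤ B := (norm_nonneg _).trans (hB' y hy)
  set ε : ℝ := m / (2 * (B + 1))
  have hε : 0 < ε := by positivity
  have hεB : ε * B ≤ m / 2 := by
    have : ε * (B + 1) = m / 2 := by simp only [ε]; field_simp
    nlinarith
  let c : Option (Fin n) → EuclideanSpace ℂ (Fin n) →L[ℂ] ℂ := fun o =>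
    o.elim 0 fun i => (ε : ℂ) • EuclideanSpace.proj i
  let f : Option (Fin n) → EuclideanSpace ℂ (Fin n) → ℂ := fun o z => evalPoly P z + c o (z - x)
  have hc : ∀ o z, ‖c o z‖ ≤ ε * ‖z‖ := by
    rintro (_ | i) z
    · simp only [c, Option.elim_none, zero_apply, norm_zero]; positivity
    · simp only [c, Option.elim_some, smul_apply, norm_smul, Complex.norm_real,
        Real.norm_eq_abs, abs_of_pos hε]
      gcongr
      exact PiLp.norm_apply_le z i
  have hf : ∀ o, ContDiff ℂ (⊤ : ℕ∞) (f o) := fun o =>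
    hP.add ((c o).contDiff.comp (contDiff_id.sub contDiff_const))
  have hfM : ∀ o, ∀ z ∈ M, m ^ 2 / 4 ≤ Complex.normSq (f o z) := by
    intro o z hz
    have h1 : m ≤ ‖evalPoly P z‖ := hmin hz
    have h2 : ‖c o (z - x)‖ ≤ m / 2 :=
      (hc o _).trans ((mul_le_mul_of_nonneg_left (hB' z hz) hε.le).trans hεB)
    have h3 : m / 2 ≤ ‖f o z‖ := by
      have := norm_sub_norm_le (evalPoly P z) (-c o (z - x))
      rw [norm_neg, sub_neg_eq_add] at this
      simp only [f]
      linarith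
    rw [Complex.normSq_eq_norm_sq]
    nlinarith
  have hfx : ∀ o, f o x = 0 := fun o => by simp [f, hPx]
  have hfd : ∀ o v, fderiv ℂ (f o) x v = fderiv ℂ (evalPoly P) x v + c o v := by
    intro o v
    have h1 : HasFDerivAt (fun z => c o (z - x)) (c o) x :=
      (c o).hasFDerivAt.comp x ((hasFDerivAt_id x).sub_const x)
    have h2 : HasFDerivAt (f o) (fderiv ℂ (evalPoly P) x + c o) x :=
      ((hP.differentiable (by simp)) x).hasFDerivAt.add h1
    rw [h2.fderiv, add_apply]
  obtain ⟨G, hG, hG0, hGM, hGx⟩ := exists_subharmonic_profile (δ := m ^ 2 / 4) (by positivity)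
  have hG2 : ContDiff ℝ 2 G := hG.of_le (WithTop.coe_le_coe.2 le_top)
  have hφ : ∀ o, IsPshFlatOn (fun z => G (Complex.normSq (f o z))) M := fun o =>
    { contDiff := hG.comp (contDiff_normSq.comp ((hf o).restrict_scalars ℝ))
      nonneg := fun p v => by
        rw [sliceLaplacian_comp_normSq ((hf o).differentiable (by simp)) hG2]
        exact mul_nonneg (mul_nonneg (by norm_num) (Complex.normSq_nonneg _))
          (hG0 _ (Complex.normSq_nonneg _))
      flat := fun p hp v => by
        rw [sliceLaplacian_comp_normSq ((hf o).differentiable (by simp)) hG2,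
          hGM _ (hfM o p hp), mul_zero] }
  refine ⟨_, IsPshFlatOn.sum (s := Finset.univ) fun o _ => hφ o,
    strictPshAt_sum (fun o _ => (hφ o).contDiff_two.contDiffAt) (fun o _ => (hφ o).nonneg x) ?_⟩
  intro v hv
  by_contra! hcon
  have hz : ∀ o, fderiv ℂ (evalPoly P) x v + c o v = 0 := by
    intro o
    have h1 := hcon o (Finset.mem_univ _)
    rw [sliceLaplacian_comp_normSq ((hf o).differentiable (by simp)) hG2, hfx, map_zero, zero_mul,
      add_zero, hfd] at h1
    by_contra hne
    have := Complex.normSq_pos.2 hne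
    have : 0 < 4 * Complex.normSq (fderiv ℂ (evalPoly P) x v + c o v) * deriv G 0 := by positivity
    linarith
  refine hv (PiLp.ext fun i => ?_)
  have h1 := hz none
  have h2 := hz (some i)
  simp only [c, Option.elim_none, zero_apply, add_zero] at h1
  rw [h1] at h2
  simpa [c, hε.ne'] using h2

lemma exists_isPshFlatOn_strictPshOn (hM : IsCompact M) (hne : M.Nonempty)
    {K : Set (EuclideanSpace ℂ (Fin n))} (hK : IsCompact K) (hKM : Disjoint K (ratHull M)) :
    ∃ φ, IsPshFlatOn φ M ∧ StrictPshOn φ K := by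
  have h : ∀ x ∈ K, ∃ φ, IsPshFlatOn φ M ∧ StrictPshAt φ x := fun x hx =>
    exists_isPshFlatOn_strictPshAt hM hne (Set.disjoint_left.1 hKM hx)
  choose! φ hφ hφx using h
  obtain ⟨t, htK, ht⟩ := hK.elim_nhds_subcover (fun x => {y | StrictPshAt (φ x) y})
    fun x hx => (isOpen_setOf_strictPshAt (hφ x hx).contDiff_two).mem_nhds (hφx x hx)
  refine ⟨_, IsPshFlatOn.sum fun i hi => hφ i (htK i hi), fun y hy =>
    strictPshAt_sum (fun i hi => (hφ i (htK i hi)).contDiff_two.contDiffAt)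
      (fun i hi => (hφ i (htK i hi)).nonneg y) fun v hv => ?_⟩
  obtain ⟨i, hi, hiy⟩ := Set.mem_iUnion₂.1 (ht hy)
  exact ⟨i, hi, hiy v hv⟩

/-- A plurisubharmonic function vanishing to second order on a ball and strictly plurisubharmonic
outside it. -/
lemma exists_isPshFlatOn_closedBall (n : ℕ) (R : ℝ) (hR : 0 < R) :
    ∃ φ : EuclideanSpace ℂ (Fin n) → ℝ, IsPshFlatOn φ (Metric.closedBall 0 R) ∧
      ∀ x, R < ‖x‖ → StrictPshAt φ x := by
  set q : ℝ → ℝ := fun t => Real.smoothTransition (t - R ^ 2)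
  have hq : ContDiff ℝ (⊤ : ℕ∞) q := Real.smoothTransition.contDiff.comp (by fun_prop)
  set G : ℝ → ℝ := fun s => ∫ t in (0 : ℝ)..s, q t
  have hGd : ∀ s, HasDerivAt G (q s) s := fun s =>
    (hq.continuous.integral_hasStrictDerivAt 0 s).hasDerivAt
  have hGd' : deriv G = q := funext fun s => (hGd s).deriv
  have hG : ContDiff ℝ (⊤ : ℕ∞) G := by
    rw [contDiff_infty_iff_deriv, hGd']
    exact ⟨fun s => (hGd s).differentiableAt, hq⟩
  have hG2 : ContDiff ℝ 2 G := hG.of_le (WithTop.coe_le_coe.2 le_top)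
  have hmono : Monotone q := fun a b hab => Real.smoothTransition.monotone (by linarith)
  have hq0 : ∀ s, s ≤ R ^ 2 → q s = 0 := fun s hs =>
    Real.smoothTransition.zero_of_nonpos (by linarith)
  have hq0' : ∀ s, s ≤ R ^ 2 → deriv q s = 0 := fun s hs => by
    refine IsLocalMin.deriv_eq_zero (Filter.Eventually.of_forall fun t => ?_)
    rw [hq0 s hs]
    exact Real.smoothTransition.nonneg _
  have hN : ∀ x v : EuclideanSpace ℂ (Fin n), HasLaplacianAtZero
      (fun lam : ℂ => ‖x + lam • v‖ ^ 2) (4 * ‖v‖ ^ 2) := by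
    intro x v
    have h1 : ∀ i ∈ (Finset.univ : Finset (Fin n)), HasLaplacianAtZero
        (fun lam : ℂ => ((x i + lam * v i) * conj (x i + lam * v i)).re)
        (4 * (v i * conj (v i)).re) := by
      intro i _
      have h2 : AnalyticAt ℂ (fun lam : ℂ => x i + lam * v i) 0 := by fun_prop
      have h3 : deriv (fun lam : ℂ => x i + lam * v i) 0 = v i := by
        simp
      simpa only [h3] using hasLaplacianAtZero_re_mul_conj h2 h2
    have h2 := HasLaplacianAtZero.sum h1
    simp only [Complex.mul_conj, Complex.ofReal_re, Complex.normSq_eq_norm_sq] at h2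
    simpa only [EuclideanSpace.norm_sq_eq, Finset.mul_sum, PiLp.add_apply, PiLp.smul_apply,
      smul_eq_mul] using h2
  have key : ∀ x v, sliceLaplacian (fun y : EuclideanSpace ℂ (Fin n) => G (‖y‖ ^ 2)) x v =
      q (‖x‖ ^ 2) * (4 * ‖v‖ ^ 2) + deriv q (‖x‖ ^ 2) *
      (fderiv ℝ (fun lam : ℂ => ‖x + lam • v‖ ^ 2) 0 1 ^ 2 +
        fderiv ℝ (fun lam : ℂ => ‖x + lam • v‖ ^ 2) 0 Complex.I ^ 2) := by
    intro x v
    have h := ((hN x v).comp hG2).2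
    simp only [hGd', zero_smul, add_zero] at h
    exact h
  refine ⟨fun y => G (‖y‖ ^ 2), ⟨hG.comp (contDiff_norm_sq ℝ), fun x v => ?_, fun x hx v => ?_⟩,
    fun x hx v hv => ?_⟩
  · rw [key]
    have h1 : 0 ≤ q (‖x‖ ^ 2) := Real.smoothTransition.nonneg _
    have h2 : 0 ≤ deriv q (‖x‖ ^ 2) := hmono.deriv_nonneg
    positivity
  · have hx' : ‖x‖ ^ 2 ≤ R ^ 2 := by
      rw [mem_closedBall_zero_iff] at hx
      gcongr
    rw [key, hq0 _ hx', hq0' _ hx']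
    simp
  · rw [key]
    have h1 : 0 < q (‖x‖ ^ 2) := Real.smoothTransition.pos_of_pos (by
      have : R ^ 2 < ‖x‖ ^ 2 := by gcongr
      linarith)
    have h2 : 0 ≤ deriv q (‖x‖ ^ 2) := hmono.deriv_nonneg
    have h3 : 0 < ‖v‖ := norm_pos_iff.2 hv
    positivity

end PolynomialPart

section HolomorphicSmooth

open Filter Topology Metric MeasureTheory

variable {n : ℕ}

lemma differentiableOn_fderiv_apply {f : EuclideanSpace ℂ (Fin n) → ℂ}
    {U : Set (EuclideanSpace ℂ (Fin n))} (hU : IsOpen U) (hf : DifferentiableOn ℂ f U)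
    (v : EuclideanSpace ℂ (Fin n)) : DifferentiableOn ℂ (fun x => fderiv ℂ f x v) U := by
  intro x₀ hx₀
  refine DifferentiableAt.differentiableWithinAt ?_
  obtain ⟨ε, hε, hεU⟩ : ∃ ε > 0, ∀ y ∈ ball x₀ ε, y ∈ U ∧ ‖f y - f x₀‖ < 1 := by
    have h1 : ∀ᶠ y in 𝓝 x₀, ‖f y - f x₀‖ < 1 := by
      have := (hf.continuousOn.continuousAt (hU.mem_nhds hx₀)).eventually (ball_mem_nhds _ one_pos)
      simpa [dist_eq_norm] using this
    obtain ⟨ε, hε, h⟩ := Metric.eventually_nhds_iff_ball.1 ((hU.eventually_mem hx₀).and h1)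
    exact ⟨ε, hε, h⟩
  set R : ℝ := ε / 4 with hR
  have hR0 : 0 < R := by positivity
  have hball : ball x₀ (4 * R) ⊆ U := fun y hy =>
    (hεU y (by simpa [hR, mul_div_cancel₀] using hy)).1
  have hbound : ∀ y ∈ ball x₀ (4 * R), ‖f y - f x₀‖ < 1 := fun y hy =>
    (hεU y (by simpa [hR, mul_div_cancel₀] using hy)).2
  have hdiff : ∀ y ∈ ball x₀ (4 * R), DifferentiableAt ℂ f y := fun y hy =>
    hf.differentiableAt (hU.mem_nhds (hball hy))
  set r : ℝ := R / (‖v‖ + 1)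
  have hr0 : 0 < r := by positivity
  have hrv : r * ‖v‖ ≤ R := by
    have : r * (‖v‖ + 1) = R := by simp only [r]; field_simp
    nlinarith
  have hmem : ∀ x ∈ ball x₀ R, ∀ w : ℂ, ‖w‖ ≤ r → x + w • v ∈ ball x₀ (2 * R) := by
    intro x hx w hw
    rw [mem_ball_iff_norm] at hx ⊢
    have h1 : ‖w • v‖ ≤ R := by
      rw [norm_smul]
      exact (mul_le_mul_of_nonneg_right hw (norm_nonneg _)).trans hrv
    calc ‖x + w • v - x₀‖ = ‖(x - x₀) + w • v‖ := by congr 1; abel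
      _ ≤ ‖x - x₀‖ + ‖w • v‖ := norm_add_le _ _
      _ < 2 * R := by linarith
  have h24 : ball x₀ (2 * R) ⊆ ball x₀ (4 * R) := ball_subset_ball (by linarith)
  have hfd : ∀ y ∈ ball x₀ (2 * R), ‖fderiv ℂ f y‖ ≤ 2 / R := by
    intro y hy
    have hsub : ball y R ⊆ ball x₀ (4 * R) := ball_subset_ball' (by
      rw [mem_ball] at hy; linarith)
    refine Complex.norm_fderiv_le_div_of_mapsTo_ball
      (fun z hz => (hdiff z (hsub hz)).differentiableWithinAt) (fun z hz => ?_) hR0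
    rw [mem_closedBall_iff_norm]
    calc ‖f z - f y‖ = ‖(f z - f x₀) - (f y - f x₀)‖ := by congr 1; abel
      _ ≤ ‖f z - f x₀‖ + ‖f y - f x₀‖ := norm_sub_le _ _
      _ ≤ 2 := by linarith [hbound z (hsub hz), hbound y (h24 hy)]
  set c : ℝ → ℂ := fun θ => deriv (circleMap 0 r) θ * ((circleMap 0 r θ - 0) ^ 2)⁻¹
  have hc : Continuous c := by
    have h1 : Continuous (deriv (circleMap 0 r)) := by
      have : deriv (circleMap 0 r) = fun θ => circleMap 0 r θ * Complex.I :=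
        funext fun θ => deriv_circleMap 0 r θ
      rw [this]; fun_prop
    refine h1.mul (Continuous.inv₀ (by fun_prop) fun θ => ?_)
    simpa using circleMap_ne_center (c := 0) (θ := θ) hr0.ne'
  have hcirc : ∀ θ, ‖circleMap 0 r θ‖ ≤ r := fun θ => by simp [abs_of_pos hr0]
  have hF : ∀ x ∈ ball x₀ R, Continuous fun θ => c θ * f (x + circleMap 0 r θ • v) := by
    intro x hx
    refine hc.mul ?_
    rw [continuous_iff_continuousAt]
    intro θ
    exact ContinuousAt.comp (g := f) (f := fun θ => x + circleMap 0 r θ • v)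
      (hdiff _ (h24 (hmem x hx _ (hcirc θ)))).continuousAt (by fun_prop)
  have hderiv : HasFDerivAt (fun x => ∫ θ in (0 : ℝ)..2 * Real.pi, c θ * f (x + circleMap 0 r θ • v))
      (∫ θ in (0 : ℝ)..2 * Real.pi, c θ • fderiv ℂ f (x₀ + circleMap 0 r θ • v)) x₀ := by
    refine intervalIntegral.hasFDerivAt_integral_of_dominated_of_fderiv_le
      (F' := fun x θ => c θ • fderiv ℂ f (x + circleMap 0 r θ • v))
      (bound := fun θ => ‖c θ‖ * (2 / R)) (ball_mem_nhds x₀ hR0) ?_ ?_ ?_ ?_ ?_ ?_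
    · filter_upwards [ball_mem_nhds x₀ hR0] with x hx
      exact (hF x hx).aestronglyMeasurable
    · exact (hF x₀ (mem_ball_self hR0)).intervalIntegrable _ _
    · refine Measurable.aestronglyMeasurable ?_
      exact hc.measurable.smul ((measurable_fderiv ℂ f).comp (by fun_prop))
    · refine .of_forall fun θ _ x hx => ?_
      rw [norm_smul]
      gcongr
      exact hfd _ (hmem x hx _ (hcirc θ))
    · exact Continuous.intervalIntegrable (by fun_prop) _ _
    · refine .of_forall fun θ _ x hx => ?_
      have h1 : HasFDerivAt (fun x => f (x + circleMap 0 r θ • v))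
          (fderiv ℂ f (x + circleMap 0 r θ • v)) x :=
        (hdiff _ (h24 (hmem x hx _ (hcirc θ)))).hasFDerivAt.comp x
          ((hasFDerivAt_id x).add_const _)
      exact h1.const_mul (c θ)
  have heq : (fun x => fderiv ℂ f x v) =ᶠ[𝓝 x₀] fun x => (2 * Real.pi * Complex.I : ℂ)⁻¹ *
      ∫ θ in (0 : ℝ)..2 * Real.pi, c θ * f (x + circleMap 0 r θ • v) := by
    filter_upwards [ball_mem_nhds x₀ hR0] with x hx
    have hxd : DifferentiableAt ℂ f x := by
      simpa using hdiff _ (h24 (hmem x hx 0 (by simpa using hr0.le)))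
    have hsub : closedBall (0 : ℂ) r ⊆ (fun lam : ℂ => x + lam • v) ⁻¹' ball x₀ (4 * R) := by
      intro lam hlam
      rw [mem_closedBall_zero_iff] at hlam
      exact h24 (hmem x hx lam hlam)
    have hsd : DifferentiableOn ℂ (fun lam : ℂ => f (x + lam • v))
        ((fun lam : ℂ => x + lam • v) ⁻¹' ball x₀ (4 * R)) := by
      intro lam hlam
      have h1 : DifferentiableAt ℂ f (x + lam • v) := hdiff _ (Set.mem_preimage.1 hlam)
      have h2 : DifferentiableAt ℂ (fun lam : ℂ => x + lam • v) lam := by fun_prop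
      exact (h1.comp lam h2).differentiableWithinAt
    rw [← (hasDerivAt_slice hxd v).deriv, ← Complex.cderiv_eq_deriv
      (isOpen_ball.preimage (by fun_prop)) hsd hr0 hsub]
    simp only [Complex.cderiv, circleIntegral, smul_eq_mul, c, mul_assoc]
  exact (hderiv.differentiableAt.const_mul _).congr_of_eventuallyEq heq

lemma contDiffOn_infty_of_differentiableOn_complex {f : EuclideanSpace ℂ (Fin n) → ℂ}
    {U : Set (EuclideanSpace ℂ (Fin n))} (hU : IsOpen U) (hf : DifferentiableOn ℂ f U) :
    ContDiffOn ℂ (⊤ : ℕ∞) f U := by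
  rw [contDiffOn_infty]
  intro m
  induction m generalizing f with
  | zero => simpa using hf.continuousOn
  | succ m ih =>
    rw [Nat.cast_succ, contDiffOn_succ_iff_fderiv_of_isOpen hU]
    exact ⟨hf, by simp, contDiffOn_clm_apply.2 fun v =>
      ih (differentiableOn_fderiv_apply hU hf v)⟩

end HolomorphicSmooth

section TotallyReal

open Filter Topology

lemma span_tangentConeAt_halfSpace {d : ℕ} (hd : 0 < d) {x : EuclideanSpace ℝ (Fin d)}
    (hx : x ∈ halfSpace d hd) : Submodule.span ℝ (tangentConeAt ℝ (halfSpace d hd) x) = ⊤ := by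
  have hlin : IsLinearMap ℝ fun y : EuclideanSpace ℝ (Fin d) => y ⟨0, hd⟩ :=
    ⟨fun _ _ => rfl, fun _ _ => rfl⟩
  refine Convex.span_tangentConeAt (convex_halfSpace_ge hlin 0) ?_ (subset_closure hx)
  have hopen : IsOpen {y : EuclideanSpace ℝ (Fin d) | 0 < y ⟨0, hd⟩} :=
    isOpen_lt continuous_const (by fun_prop)
  refine ⟨EuclideanSpace.single ⟨0, hd⟩ 1, interior_mono (fun y hy => ?_)
    (hopen.subset_interior_iff.2 subset_rfl ?_)⟩
  · exact le_of_lt (Set.mem_ofPred_eq ▸ hy)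
  · simp

variable {n : ℕ}

lemma fderiv_fderiv_norm_sq_self {g : EuclideanSpace ℂ (Fin n) → EuclideanSpace ℂ (Fin n)}
    {p : EuclideanSpace ℂ (Fin n)} (hg : ContDiffAt ℝ 2 g p) (hp : g p = 0)
    (w : EuclideanSpace ℂ (Fin n)) :
    fderiv ℝ (fderiv ℝ fun x => ‖g x‖ ^ 2) p w w = 2 * ‖fderiv ℝ g p w‖ ^ 2 := by
  have hρ : ContDiffAt ℝ 2 (fun x => ‖g x‖ ^ 2) p := hg.norm_sq ℝ
  rw [fderiv_fderiv_self_eq_deriv_deriv hρ]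
  have hl : ContDiff ℝ 2 (fun t : ℝ => p + t • w) := by fun_prop
  have hγ : ContDiffAt ℝ 2 (fun t : ℝ => g (p + t • w)) 0 :=
    ContDiffAt.comp (0 : ℝ) (by simpa using hg) hl.contDiffAt
  set γ : ℝ → EuclideanSpace ℂ (Fin n) := fun t => g (p + t • w) with hγdef
  have h1 : deriv (fun t : ℝ => ‖γ t‖ ^ 2) =ᶠ[𝓝 0] fun t => 2 * inner ℝ (γ t) (deriv γ t) := by
    filter_upwards [hγ.eventually (by simp)] with t ht
    exact ((ht.differentiableAt (by simp)).hasDerivAt.norm_sq).deriv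
  have h0 : γ 0 = 0 := by simp [hγdef, hp]
  have h2 : HasDerivAt γ (deriv γ 0) 0 := (hγ.differentiableAt (by simp)).hasDerivAt
  have h3 : DifferentiableAt ℝ (deriv γ) 0 :=
    ((hγ.fderiv_right (m := 1) (by norm_num)).differentiableAt (by simp)).clm_apply
      (differentiableAt_const 1)
  have h4 := ((h2.inner ℝ h3.hasDerivAt).const_mul 2).deriv
  have h5 : deriv γ 0 = fderiv ℝ g p w := by
    have hline : HasDerivAt (fun t : ℝ => p + t • w) w 0 := by
      simpa using ((hasDerivAt_id (0 : ℝ)).smul_const w).const_add p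
    exact (HasFDerivAt.comp_hasDerivAt (l := g) (f := fun t : ℝ => p + t • w) (0 : ℝ)
      (by simpa using (hg.differentiableAt (by simp)).hasFDerivAt) hline).deriv
  rw [h1.deriv_eq, h4, h0, inner_zero_left, zero_add, real_inner_self_eq_norm_sq, h5]

/-- Near a totally real point, the squared distance to `M` along a linear projection is strictly
plurisubharmonic. -/
lemma exists_local_strictPshAt_of_totallyRealAt {d : ℕ} {hd : 0 < d}
    {M : Set (EuclideanSpace ℂ (Fin n))} (hM : IsSubmanifold d hd M)
    {p : EuclideanSpace ℂ (Fin n)} (hp : p ∈ M) (htr : TotallyRealAt M p) :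
    ∃ (ρ : EuclideanSpace ℂ (Fin n) → ℝ) (U : Set (EuclideanSpace ℂ (Fin n))),
      IsOpen U ∧ p ∈ U ∧ ContDiffOn ℝ (⊤ : ℕ∞) ρ U ∧ (∀ x, 0 ≤ ρ x) ∧
      (∀ x ∈ M ∩ U, ρ x = 0) ∧ StrictPshAt ρ p := by
  obtain ⟨V, U₁, f, hV, -, hpU₁, hf, -, hinj, himage, hrel⟩ := hM p hp
  obtain ⟨x₀, ⟨hx₀V, hx₀H⟩, hfx₀⟩ : p ∈ f '' (V ∩ halfSpace d hd) := himage ▸ ⟨hp, hpU₁⟩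
  have hfat : ∀ x ∈ V, ContDiffAt ℝ (⊤ : ℕ∞) f x := fun x hx => hf.contDiffAt (hV.mem_nhds hx)
  have hfd : ∀ x ∈ V, HasFDerivAt f (fderiv ℝ f x) x := fun x hx =>
    ((hfat x hx).differentiableAt (by simp)).hasFDerivAt
  obtain ⟨π₀, hπ₀⟩ := (fderiv ℝ f x₀).toLinearMap.exists_leftInverse_of_injective
    (LinearMap.ker_eq_bot.2 (hinj x₀ hx₀V))
  set π : EuclideanSpace ℂ (Fin n) →L[ℝ] EuclideanSpace ℝ (Fin d) := LinearMap.toContinuousLinearMap π₀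
  have hπ : π.comp (fderiv ℝ f x₀) = ContinuousLinearMap.id ℝ _ := by
    ext1 y
    exact LinearMap.congr_fun hπ₀ y
  set h : EuclideanSpace ℝ (Fin d) → EuclideanSpace ℝ (Fin d) := fun x => π (f x)
  have hh : ∀ x ∈ V, ContDiffAt ℝ (⊤ : ℕ∞) h x := fun x hx =>
    π.contDiff.contDiffAt.comp x (hfat x hx)
  have hhd : ∀ x ∈ V, HasFDerivAt h (π.comp (fderiv ℝ f x)) x := fun x hx =>
    π.hasFDerivAt.comp x (hfd x hx)
  have hhd₀ : HasFDerivAt h ((ContinuousLinearEquiv.refl ℝ (EuclideanSpace ℝ (Fin d)) :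
      EuclideanSpace ℝ (Fin d) ≃L[ℝ] EuclideanSpace ℝ (Fin d)) :
      EuclideanSpace ℝ (Fin d) →L[ℝ] EuclideanSpace ℝ (Fin d)) x₀ := by
    have := hhd x₀ hx₀V
    rwa [hπ] at this
  set e := (hh x₀ hx₀V).toOpenPartialHomeomorph h hhd₀ (by simp)
  have he : (e : EuclideanSpace ℝ (Fin d) → EuclideanSpace ℝ (Fin d)) = h :=
    (hh x₀ hx₀V).toOpenPartialHomeomorph_coe hhd₀ (by simp)
  have hx₀e : x₀ ∈ e.source := (hh x₀ hx₀V).mem_toOpenPartialHomeomorph_source hhd₀ (by simp)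
  set W : Set (EuclideanSpace ℝ (Fin d)) := (V ∩ (fun x => π.comp (fderiv ℝ f x)) ⁻¹'
    Set.range ((↑) : (EuclideanSpace ℝ (Fin d) ≃L[ℝ] EuclideanSpace ℝ (Fin d)) →
      EuclideanSpace ℝ (Fin d) →L[ℝ] EuclideanSpace ℝ (Fin d))) ∩ e.source
  have hWopen : IsOpen W := by
    refine IsOpen.inter (ContinuousOn.isOpen_inter_preimage ?_ hV ContinuousLinearEquiv.isOpen)
      e.open_source
    exact continuousOn_const.clm_comp (hf.continuousOn_fderiv_of_isOpen hV (by simp))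
  have hWV : W ⊆ V := fun x hx => hx.1.1
  have hx₀W : x₀ ∈ W := by
    refine ⟨⟨hx₀V, ?_⟩, hx₀e⟩
    rw [Set.mem_preimage, hπ]
    exact ⟨ContinuousLinearEquiv.refl ℝ _, rfl⟩
  obtain ⟨U', hU', hfW⟩ := hrel W hWopen hWV
  set T := e.target ∩ e.symm ⁻¹' W
  have hT : IsOpen T := e.isOpen_inter_preimage_symm hWopen
  have hsymm : ∀ x ∈ W, e.symm (π (f x)) = x := fun x hx => by
    have := e.left_inv hx.2
    rwa [he] at this
  have hsmooth : ∀ y ∈ T, ContDiffAt ℝ (⊤ : ℕ∞) e.symm y := by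
    intro y hy
    obtain ⟨A, hA⟩ := hy.2.1.2
    refine e.contDiffAt_symm (f₀' := A) hy.1 ?_ ?_
    · rw [he, hA]; exact hhd _ (hWV hy.2)
    · rw [he]; exact hh _ (hWV hy.2)
  have hx₀T : π p ∈ T := by
    have h1 : h x₀ ∈ e.target := by rw [← he]; exact e.map_source hx₀e
    have h2 := hsymm x₀ hx₀W
    rw [hfx₀] at h2
    refine ⟨by rw [← hfx₀]; exact h1, ?_⟩
    rw [Set.mem_preimage, h2]
    exact hx₀W
  set g : EuclideanSpace ℂ (Fin n) → EuclideanSpace ℂ (Fin n) := fun y => y - f (e.symm (π y))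
  have hg : ∀ y ∈ π ⁻¹' T, ContDiffAt ℝ (⊤ : ℕ∞) g y := by
    intro y hy
    have h1 : ContDiffAt ℝ (⊤ : ℕ∞) (fun y => e.symm (π y)) y :=
      ContDiffAt.comp y (hsmooth (π y) hy) π.contDiff.contDiffAt
    exact contDiffAt_id.sub (ContDiffAt.comp y (hfat _ (hWV hy.2)) h1)
  have hgM : ∀ x ∈ M ∩ U', g x = 0 := by
    intro y hy
    rw [← hfW] at hy
    obtain ⟨x, hx, rfl⟩ := hy
    simp only [g]
    rw [hsymm x hx.1, sub_self]
  have hpU' : p ∈ M ∩ U' := by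
    rw [← hfW]
    exact ⟨x₀, ⟨hx₀W, hx₀H⟩, hfx₀⟩
  have hrange : ∀ y, fderiv ℝ f x₀ y ∈ tangentSpaceAt M p := by
    intro y
    have h1 : HasFDerivWithinAt f (fderiv ℝ f x₀) (halfSpace d hd ∩ V) x₀ :=
      (hfd x₀ hx₀V).hasFDerivWithinAt
    have h2 := h1.mapsTo_tangent_cone
    rw [tangentConeAt_inter_nhds (hV.mem_nhds hx₀V), Set.inter_comm, himage, hfx₀] at h2
    have h3 : Submodule.span ℝ (tangentConeAt ℝ (halfSpace d hd) x₀) ≤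
        (tangentSpaceAt M p).comap (fderiv ℝ f x₀).toLinearMap := by
      rw [Submodule.span_le]
      intro z hz
      exact Submodule.subset_span (tangentConeAt_mono Set.inter_subset_left (h2 hz))
    rw [span_tangentConeAt_halfSpace hd hx₀H] at h3
    exact h3 (Submodule.mem_top (x := y))
  have hg2 : ContDiffAt ℝ 2 g p := (hg p hx₀T).of_le (WithTop.coe_le_coe.2 le_top)
  have hker : ∀ v, fderiv ℝ g p v = 0 → v ∈ tangentSpaceAt M p := by
    intro v hv
    have h1 : HasFDerivAt (fun y => e.symm (π y)) ((fderiv ℝ e.symm (π p)).comp π) p :=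
      (((hsmooth _ hx₀T).differentiableAt (by simp)).hasFDerivAt).comp p π.hasFDerivAt
    have h2 : e.symm (π p) = x₀ := by rw [← hfx₀]; exact hsymm x₀ hx₀W
    have h3 : HasFDerivAt (fun y => f (e.symm (π y)))
        ((fderiv ℝ f x₀).comp ((fderiv ℝ e.symm (π p)).comp π)) p :=
      HasFDerivAt.comp (g := f) p (by rw [h2]; exact hfd x₀ hx₀V) h1
    have h4 : HasFDerivAt g (ContinuousLinearMap.id ℝ _ -
        (fderiv ℝ f x₀).comp ((fderiv ℝ e.symm (π p)).comp π)) p := (hasFDerivAt_id p).sub h3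
    rw [h4.fderiv] at hv
    have h5 : v = fderiv ℝ f x₀ (fderiv ℝ e.symm (π p) (π v)) := sub_eq_zero.1 hv
    rw [h5]
    exact hrange _
  refine ⟨fun x => ‖g x‖ ^ 2, π ⁻¹' T ∩ U', (hT.preimage π.continuous).inter hU',
    ⟨hx₀T, hpU'.2⟩, fun y hy => ((hg y hy.1).norm_sq ℝ).contDiffWithinAt, fun x => by positivity,
    fun x hx => by simp [hgM x ⟨hx.1, hx.2.2⟩], fun v hv => ?_⟩
  rw [sliceLaplacian_eq (hg2.norm_sq ℝ), fderiv_fderiv_norm_sq_self hg2 (hgM p hpU'),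
    fderiv_fderiv_norm_sq_self hg2 (hgM p hpU')]
  by_contra! hle
  have h1 : ‖fderiv ℝ g p v‖ = 0 := by
    nlinarith [sq_nonneg ‖fderiv ℝ g p v‖, sq_nonneg ‖fderiv ℝ g p (Complex.I • v)‖]
  have h2 : ‖fderiv ℝ g p (Complex.I • v)‖ = 0 := by
    nlinarith [sq_nonneg ‖fderiv ℝ g p v‖, sq_nonneg ‖fderiv ℝ g p (Complex.I • v)‖]
  exact hv (htr v (hker v (norm_eq_zero.1 h1)) (hker _ (norm_eq_zero.1 h2)))

end TotallyReal

section CRSingularity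

open Filter Topology

/-- The weighted squared defect `(1 + |z|²) |a - conj b|²` of a pair of holomorphic functions. -/
def pairDefect {X : Type*} (z a b : X → ℂ) (x : X) : ℝ :=
  (1 + Complex.normSq (z x)) * Complex.normSq (a x - conj (b x))

lemma pairDefect_nonneg {X : Type*} (z a b : X → ℂ) (x : X) : 0 ≤ pairDefect z a b x :=
  mul_nonneg (add_nonneg zero_le_one (Complex.normSq_nonneg _)) (Complex.normSq_nonneg _)

lemma exists_hasLaplacianAtZero_pairDefect {z a b : ℂ → ℂ} (hz : AnalyticAt ℂ z 0)
    (ha : AnalyticAt ℂ a 0) (hb : AnalyticAt ℂ b 0) :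
    ∃ l, HasLaplacianAtZero (pairDefect z a b) l ∧
      4 * ((1 - 3 * Complex.normSq (z 0)) *
          (Complex.normSq (deriv a 0) + Complex.normSq (deriv b 0)) +
        Complex.normSq (deriv z 0) * Complex.normSq (a 0 - conj (b 0)) / 2) ≤ l := by
  have h1 := hasLaplacianAtZero_re_mul_conj ha ha
  have h2 := hasLaplacianAtZero_re_mul_conj hb hb
  have h3 := hasLaplacianAtZero_re_mul_conj (ha.mul hb) (analyticAt_const (v := (1 : ℂ)))
  have h4 := hasLaplacianAtZero_re_mul_conj (hz.mul ha) (hz.mul ha)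
  have h5 := hasLaplacianAtZero_re_mul_conj (hz.mul hb) (hz.mul hb)
  have h6 := hasLaplacianAtZero_re_mul_conj (hz.mul (ha.mul hb)) hz
  have hsum := ((h1.add h2).add (h3.const_mul (-2))).add ((h4.add h5).add (h6.const_mul (-2)))
  refine ⟨_, hsum.congr_of_eventuallyEq (.of_forall fun x => ?_), ?_⟩
  · simp only [pairDefect, Pi.mul_apply, Complex.normSq_apply, Complex.mul_re, Complex.mul_im,
      Complex.conj_re, Complex.conj_im, Complex.sub_re, Complex.sub_im, Complex.one_re,
      Complex.one_im]
    ring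
  · have da := ha.differentiableAt.hasDerivAt
    have db := hb.differentiableAt.hasDerivAt
    have dz := hz.differentiableAt.hasDerivAt
    rw [(dz.mul da).deriv, (dz.mul db).deriv, (dz.mul (da.mul db)).deriv, (da.mul db).deriv,
      deriv_const]
    simp only [Pi.mul_apply]
    generalize deriv a 0 = a', deriv b 0 = b', deriv z 0 = z', a 0 = a, b 0 = b, z 0 = z
    rw [← sub_nonneg]
    have key := add_nonneg (Complex.normSq_nonneg (z' * (a - conj b) + 4 * (z * a')))
      (Complex.normSq_nonneg (z' * (conj a - b) - 4 * (z * b')))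
    refine key.trans_eq ?_
    simp only [Complex.normSq_apply, Complex.mul_re, Complex.mul_im, Complex.add_re,
      Complex.add_im, Complex.conj_re, Complex.conj_im, Complex.sub_re, Complex.sub_im,
      Complex.zero_re, Complex.zero_im, Complex.re_ofNat, Complex.im_ofNat]
    ring

variable {n : ℕ} {z a b : EuclideanSpace ℂ (Fin n) → ℂ} {x v : EuclideanSpace ℂ (Fin n)}

lemma le_sliceLaplacian_pairDefect (hz : ∀ᶠ y in 𝓝 x, DifferentiableAt ℂ z y)
    (ha : ∀ᶠ y in 𝓝 x, DifferentiableAt ℂ a y) (hb : ∀ᶠ y in 𝓝 x, DifferentiableAt ℂ b y) :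
    4 * ((1 - 3 * Complex.normSq (z x)) *
        (Complex.normSq (fderiv ℂ a x v) + Complex.normSq (fderiv ℂ b x v)) +
      Complex.normSq (fderiv ℂ z x v) * Complex.normSq (a x - conj (b x)) / 2) ≤
      sliceLaplacian (pairDefect z a b) x v := by
  obtain ⟨l, hl, hle⟩ := exists_hasLaplacianAtZero_pairDefect (analyticAt_slice hz v)
    (analyticAt_slice ha v) (analyticAt_slice hb v)
  rw [(hasDerivAt_slice hz.self_of_nhds v).deriv, (hasDerivAt_slice ha.self_of_nhds v).deriv,
    (hasDerivAt_slice hb.self_of_nhds v).deriv] at hle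
  simp only [zero_smul, add_zero] at hle
  have : sliceLaplacian (pairDefect z a b) x v = l := hl.2
  rwa [this]

lemma sliceLaplacian_pairDefect_nonneg (hz : ∀ᶠ y in 𝓝 x, DifferentiableAt ℂ z y)
    (ha : ∀ᶠ y in 𝓝 x, DifferentiableAt ℂ a y) (hb : ∀ᶠ y in 𝓝 x, DifferentiableAt ℂ b y)
    (hzx : Complex.normSq (z x) < 1 / 3) : 0 ≤ sliceLaplacian (pairDefect z a b) x v := by
  refine le_trans ?_ (le_sliceLaplacian_pairDefect hz ha hb)
  have h1 : 0 ≤ 1 - 3 * Complex.normSq (z x) := by linarith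
  have := Complex.normSq_nonneg
  have := mul_nonneg h1 (add_nonneg (this (fderiv ℂ a x v)) (this (fderiv ℂ b x v)))
  have := mul_nonneg (Complex.normSq_nonneg (fderiv ℂ z x v))
    (Complex.normSq_nonneg (a x - conj (b x)))
  positivity

lemma eq_zero_of_sliceLaplacian_pairDefect_nonpos (hz : ∀ᶠ y in 𝓝 x, DifferentiableAt ℂ z y)
    (ha : ∀ᶠ y in 𝓝 x, DifferentiableAt ℂ a y) (hb : ∀ᶠ y in 𝓝 x, DifferentiableAt ℂ b y)
    (hzx : Complex.normSq (z x) < 1 / 3) (h : sliceLaplacian (pairDefect z a b) x v ≤ 0) :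
    fderiv ℂ a x v = 0 ∧ fderiv ℂ b x v = 0 ∧ (fderiv ℂ z x v = 0 ∨ a x = conj (b x)) := by
  have hle := (le_sliceLaplacian_pairDefect (v := v) hz ha hb).trans h
  have h1 : 0 < 1 - 3 * Complex.normSq (z x) := by linarith
  have ha0 := Complex.normSq_nonneg (fderiv ℂ a x v)
  have hb0 := Complex.normSq_nonneg (fderiv ℂ b x v)
  have h2 := mul_nonneg (Complex.normSq_nonneg (fderiv ℂ z x v))
    (Complex.normSq_nonneg (a x - conj (b x)))
  have h3 : (1 - 3 * Complex.normSq (z x)) *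
      (Complex.normSq (fderiv ℂ a x v) + Complex.normSq (fderiv ℂ b x v)) = 0 := by
    have := mul_nonneg h1.le (add_nonneg ha0 hb0)
    linarith
  have h4 := (mul_eq_zero.1 h3).resolve_left h1.ne'
  have h5 : Complex.normSq (fderiv ℂ z x v) * Complex.normSq (a x - conj (b x)) = 0 := by
    linarith
  refine ⟨Complex.normSq_eq_zero.1 (by linarith), Complex.normSq_eq_zero.1 (by linarith), ?_⟩
  simpa [sub_eq_zero] using h5

end CRSingularity

section NormalForm

open Filter Topology

/-- The `m`-th coordinate functional, extended by `0` to `m ≥ n`. -/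
def natCoord (n m : ℕ) : EuclideanSpace ℂ (Fin n) →L[ℂ] ℂ :=
  if h : m < n then EuclideanSpace.proj ⟨m, h⟩ else 0

lemma natCoord_apply {n m : ℕ} (h : m < n) (Z : EuclideanSpace ℂ (Fin n)) :
    natCoord n m Z = Z ⟨m, h⟩ := by
  simp [natCoord, h]

/-- The functional `w_{2σ-1} - i w_{2σ}`. -/
def conjCoord (n σ : ℕ) : EuclideanSpace ℂ (Fin n) →L[ℂ] ℂ :=
  natCoord n (2 * σ - 1) - Complex.I • natCoord n (2 * σ)

open Classical in
/-- Pairs `(a, b)` of holomorphic polynomials with `a = conj b` on the normal form. -/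
def bcPairs (k : ℕ) : Finset ((EuclideanSpace ℂ (Fin (3 * k - 1)) → ℂ) ×
    (EuclideanSpace ℂ (Fin (3 * k - 1)) → ℂ)) :=
  let X := natCoord (3 * k - 1)
  let ω' := conjCoord (3 * k - 1)
  (Finset.Icc 1 (2 * k - 2)).image (fun τ => (fun Z => X τ Z, fun Z => X τ Z)) ∪
  (Finset.Icc 2 (k - 1)).image (fun σ => (fun Z => X (2 * k - 2 + σ) Z, fun Z => X 0 Z * ω' σ Z)) ∪
  {(fun Z => X (3 * k - 2) Z, fun Z => X 0 Z * X 0 Z),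
    (fun Z => X (2 * k - 1) Z + X 0 Z * ω' 1 Z, fun Z => X (2 * k - 1) Z + X 0 Z * ω' 1 Z),
    (fun Z => X 0 Z * (X (3 * k - 2) Z - ω' 1 Z * ω' 1 Z),
      fun Z => (X 0 Z - (X 1 Z + Complex.I * X 2 Z)) * X (2 * k - 1) Z)}

variable {k : ℕ}

lemma forall_mem_bcPairs {C : (EuclideanSpace ℂ (Fin (3 * k - 1)) → ℂ) →
    (EuclideanSpace ℂ (Fin (3 * k - 1)) → ℂ) → Prop} :
    (∀ q ∈ bcPairs k, C q.1 q.2) ↔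
      (∀ τ, 1 ≤ τ → τ ≤ 2 * k - 2 →
        C (fun Z => natCoord (3 * k - 1) τ Z) (fun Z => natCoord (3 * k - 1) τ Z)) ∧
      (∀ σ, 2 ≤ σ → σ ≤ k - 1 → C (fun Z => natCoord (3 * k - 1) (2 * k - 2 + σ) Z)
        (fun Z => natCoord (3 * k - 1) 0 Z * conjCoord (3 * k - 1) σ Z)) ∧
      C (fun Z => natCoord (3 * k - 1) (3 * k - 2) Z)
        (fun Z => natCoord (3 * k - 1) 0 Z * natCoord (3 * k - 1) 0 Z) ∧
      C (fun Z => natCoord (3 * k - 1) (2 * k - 1) Z +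
          natCoord (3 * k - 1) 0 Z * conjCoord (3 * k - 1) 1 Z)
        (fun Z => natCoord (3 * k - 1) (2 * k - 1) Z +
          natCoord (3 * k - 1) 0 Z * conjCoord (3 * k - 1) 1 Z) ∧
      C (fun Z => natCoord (3 * k - 1) 0 Z * (natCoord (3 * k - 1) (3 * k - 2) Z -
          conjCoord (3 * k - 1) 1 Z * conjCoord (3 * k - 1) 1 Z))
        (fun Z => (natCoord (3 * k - 1) 0 Z - (natCoord (3 * k - 1) 1 Z +
          Complex.I * natCoord (3 * k - 1) 2 Z)) * natCoord (3 * k - 1) (2 * k - 1) Z) := by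
  simp only [bcPairs, Finset.mem_union, Finset.mem_image, Finset.mem_Icc, Finset.mem_insert,
    Finset.mem_singleton]
  constructor
  · intro h
    exact ⟨fun τ h1 h2 => h _ (.inl (.inl ⟨τ, ⟨h1, h2⟩, rfl⟩)),
      fun σ h1 h2 => h _ (.inl (.inr ⟨σ, ⟨h1, h2⟩, rfl⟩)), h _ (.inr (.inl rfl)),
      h _ (.inr (.inr (.inl rfl))), h _ (.inr (.inr (.inr rfl)))⟩
  · rintro ⟨h1, h2, h3, h4, h5⟩ q ((⟨τ, ⟨ha, hb⟩, rfl⟩ | ⟨σ, ⟨ha, hb⟩, rfl⟩) | rfl | rfl | rfl)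
    exacts [h1 τ ha hb, h2 σ ha hb, h3, h4, h5]

lemma contDiff_bcPairs : ∀ q ∈ bcPairs k, ContDiff ℂ (⊤ : ℕ∞) q.1 ∧ ContDiff ℂ (⊤ : ℕ∞) q.2 := by
  rw [forall_mem_bcPairs (C := fun a b => ContDiff ℂ (⊤ : ℕ∞) a ∧ ContDiff ℂ (⊤ : ℕ∞) b)]
  refine ⟨fun _ _ _ => ⟨?_, ?_⟩, fun _ _ _ => ⟨?_, ?_⟩, ⟨?_, ?_⟩, ⟨?_, ?_⟩, ⟨?_, ?_⟩⟩ <;> fun_prop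

lemma bcPairs_eq_conj (hk : 1 < k) {Z : EuclideanSpace ℂ (Fin (3 * k - 1))} (hZ : Z ∈ bcForm k hk) :
    ∀ q ∈ bcPairs k, q.1 Z = conj (q.2 Z) := by
  rw [forall_mem_bcPairs (C := fun a b => a Z = conj (b Z))]
  obtain ⟨hw, h1, hσ, hk'⟩ := hZ
  have hreal : ∀ τ, 1 ≤ τ → τ ≤ 2 * k - 2 → conj (natCoord (3 * k - 1) τ Z) =
      natCoord (3 * k - 1) τ Z := fun τ ha hb => by
    rw [natCoord_apply (by omega), Complex.conj_eq_iff_im]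
    exact hw τ ha hb
  have hre : ∀ τ, 1 ≤ τ → ∀ hb : τ ≤ 2 * k - 2, ((Z ⟨τ, by omega⟩).re : ℂ) =
      natCoord (3 * k - 1) τ Z := fun τ ha hb => by
    rw [natCoord_apply (by omega)]
    exact Complex.ext (by simp) (by simpa using (hw τ ha hb).symm)
  rw [Complex.normSq_eq_conj_mul_self, hre 1 (by omega) (by omega), hre 2 (by omega) (by omega)] at h1
  rw [← natCoord_apply, ← natCoord_apply] at h1 hk'
  beta_reduce at h1 hk'
  have h1' : conj (natCoord (3 * k - 1) 1 Z) = natCoord (3 * k - 1) 1 Z :=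
    hreal 1 (by omega) (by omega)
  have h2' : conj (natCoord (3 * k - 1) 2 Z) = natCoord (3 * k - 1) 2 Z :=
    hreal 2 (by omega) (by omega)
  refine ⟨fun τ ha hb => (hreal τ ha hb).symm, fun σ ha hb => ?_, ?_, ?_, ?_⟩
  · have h := hσ σ ha hb
    rw [hre (2 * σ - 1) (by omega) (by omega), hre (2 * σ) (by omega) (by omega),
      ← natCoord_apply, ← natCoord_apply] at h
    beta_reduce at h ⊢
    rw [h]
    simp [conjCoord, hreal (2 * σ - 1) (by omega) (by omega), hreal (2 * σ) (by omega) (by omega)]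
  · beta_reduce
    rw [hk']
    simp [sq]
  · beta_reduce
    rw [h1]
    simp only [conjCoord, sub_apply, smul_apply, smul_eq_mul, map_add, map_mul, map_sub,
      Complex.conj_conj, Complex.conj_I, h1', h2']
    ring
  · beta_reduce
    rw [h1, hk']
    simp only [conjCoord, sub_apply, smul_apply, smul_eq_mul, map_add, map_mul, map_sub,
      Complex.conj_conj, Complex.conj_I, h1', h2', mul_one]
    ring

/-- Infinitesimal rigidity of `bcPairs`: a direction killing all pairs to first order vanishes, or
the base point is the origin. -/
lemma eq_zero_of_fderiv_bcPairs_eq_zero (hk : 1 < k) {Z W : EuclideanSpace ℂ (Fin (3 * k - 1))}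
    (h : ∀ q ∈ bcPairs k, fderiv ℂ q.1 Z W = 0 ∧ fderiv ℂ q.2 Z W = 0 ∧
      (natCoord (3 * k - 1) 0 W = 0 ∨ q.1 Z = conj (q.2 Z))) : W = 0 ∨ Z = 0 := by
  rw [forall_mem_bcPairs (C := fun a b => fderiv ℂ a Z W = 0 ∧ fderiv ℂ b Z W = 0 ∧
      (natCoord (3 * k - 1) 0 W = 0 ∨ a Z = conj (b Z)))] at h
  have hmul : ∀ f g : EuclideanSpace ℂ (Fin (3 * k - 1)) → ℂ, DifferentiableAt ℂ f Z →
      DifferentiableAt ℂ g Z → fderiv ℂ (fun Z => f Z * g Z) Z W =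
        f Z * fderiv ℂ g Z W + g Z * fderiv ℂ f Z W := fun f g hf hg => by
    rw [fderiv_fun_mul hf hg]; rfl
  have hadd : ∀ f g : EuclideanSpace ℂ (Fin (3 * k - 1)) → ℂ, DifferentiableAt ℂ f Z →
      DifferentiableAt ℂ g Z → fderiv ℂ (fun Z => f Z + g Z) Z W =
        fderiv ℂ f Z W + fderiv ℂ g Z W := fun f g hf hg => by
    rw [fderiv_fun_add hf hg]; rfl
  have hsub : ∀ f g : EuclideanSpace ℂ (Fin (3 * k - 1)) → ℂ, DifferentiableAt ℂ f Z →
      DifferentiableAt ℂ g Z → fderiv ℂ (fun Z => f Z - g Z) Z W =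
        fderiv ℂ f Z W - fderiv ℂ g Z W := fun f g hf hg => by
    rw [fderiv_fun_sub hf hg]; rfl
  have hX : ∀ m, fderiv ℂ (fun Z => natCoord (3 * k - 1) m Z) Z W = natCoord (3 * k - 1) m W :=
    fun m => by rw [(natCoord (3 * k - 1) m).hasFDerivAt.fderiv]
  have hω : ∀ m, fderiv ℂ (fun Z => conjCoord (3 * k - 1) m Z) Z W = conjCoord (3 * k - 1) m W :=
    fun m => by rw [(conjCoord (3 * k - 1) m).hasFDerivAt.fderiv]
  have hX2 : fderiv ℂ (fun Z => natCoord (3 * k - 1) 1 Z + Complex.I * natCoord (3 * k - 1) 2 Z)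
      Z W = natCoord (3 * k - 1) 1 W + Complex.I * natCoord (3 * k - 1) 2 W :=
    by rw [hadd _ _ (by fun_prop) (by fun_prop), hmul _ _ (by fun_prop) (by fun_prop), hX, hX]; simp
  obtain ⟨hw, hσ, hζk, hη, hlast⟩ := h
  simp only [hX] at hw
  have hωW : ∀ σ, 1 ≤ σ → σ ≤ k - 1 → conjCoord (3 * k - 1) σ W = 0 := fun σ ha hb => by
    simp [conjCoord, (hw (2 * σ - 1) (by omega) (by omega)).1, (hw (2 * σ) (by omega) (by omega)).1]
  rw [hX, hmul _ _ (by fun_prop) (by fun_prop), hX] at hζk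
  rw [hadd _ _ (by fun_prop) (by fun_prop), hmul _ _ (by fun_prop) (by fun_prop), hX, hX, hω,
    hωW 1 le_rfl (by omega)] at hη
  rw [hmul _ _ (by fun_prop) (by fun_prop), hsub _ _ (by fun_prop) (by fun_prop),
    hmul _ _ (by fun_prop) (by fun_prop), hmul _ _ (by fun_prop) (by fun_prop),
    hsub _ _ (by fun_prop) (by fun_prop), hX2, hX, hX, hX, hω, hωW 1 le_rfl (by omega),
    (hw 1 (by omega) (by omega)).1, (hw 2 (by omega) (by omega)).1, hζk.1] at hlast
  have hσ' : ∀ σ, 2 ≤ σ → σ ≤ k - 1 → natCoord (3 * k - 1) (2 * k - 2 + σ) W = 0 ∧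
      conjCoord (3 * k - 1) σ Z * natCoord (3 * k - 1) 0 W = 0 := fun σ ha hb => by
    have := hσ σ ha hb
    rw [hX, hmul _ _ (by fun_prop) (by fun_prop), hX, hω, hωW σ (by omega) hb] at this
    exact ⟨this.1, by simpa using this.2.1⟩
  have hext : ∀ Y : EuclideanSpace ℂ (Fin (3 * k - 1)), natCoord (3 * k - 1) 0 Y = 0 →
      (∀ τ, 1 ≤ τ → τ ≤ 2 * k - 2 → natCoord (3 * k - 1) τ Y = 0) →
      natCoord (3 * k - 1) (2 * k - 1) Y = 0 →
      (∀ σ, 2 ≤ σ → σ ≤ k - 1 → natCoord (3 * k - 1) (2 * k - 2 + σ) Y = 0) →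
      natCoord (3 * k - 1) (3 * k - 2) Y = 0 → Y = 0 := by
    intro Y h0 hw h1 hs hk'
    have : ∀ m, m < 3 * k - 1 → natCoord (3 * k - 1) m Y = 0 := by
      intro m hm
      rcases Nat.eq_zero_or_pos m with rfl | hpos
      · exact h0
      rcases le_or_gt m (2 * k - 2) with h | h
      · exact hw m hpos h
      rcases eq_or_ne m (2 * k - 1) with rfl | hne
      · exact h1
      rcases eq_or_ne m (3 * k - 2) with rfl | hne'
      · exact hk'
      have := hs (m - (2 * k - 2)) (by omega) (by omega)
      rwa [show 2 * k - 2 + (m - (2 * k - 2)) = m by omega] at this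
    refine PiLp.ext fun i => ?_
    have := this i.1 i.2
    rwa [natCoord_apply i.2] at this
  by_cases hz : natCoord (3 * k - 1) 0 W = 0
  · left
    refine hext W hz (fun τ ha hb => (hw τ ha hb).1) ?_ (fun σ ha hb => (hσ' σ ha hb).1) hζk.1
    simpa [hz] using hη.1
  · right
    have hz0 : natCoord (3 * k - 1) 0 Z = 0 := by simpa [hz, ← two_mul] using hζk.2.1
    have hζk0 : natCoord (3 * k - 1) (3 * k - 2) Z = 0 := by
      simpa [hz0] using hζk.2.2.resolve_left hz
    have hω0 : ∀ σ, 1 ≤ σ → σ ≤ k - 1 → conjCoord (3 * k - 1) σ Z = 0 := by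
      intro σ ha hb
      rcases ha.eq_or_lt with rfl | ha
      · simpa [hζk0, hz, hz0] using hlast.1
      · exact (mul_eq_zero.1 (hσ' σ ha hb).2).resolve_right hz
    have hw0 : ∀ σ, 1 ≤ σ → σ ≤ k - 1 → natCoord (3 * k - 1) (2 * σ - 1) Z = 0 ∧
        natCoord (3 * k - 1) (2 * σ) Z = 0 := by
      intro σ ha hb
      have h1 := (hw (2 * σ - 1) (by omega) (by omega)).2.2.resolve_left hz
      have h2 := (hw (2 * σ) (by omega) (by omega)).2.2.resolve_left hz
      have h3 := hω0 σ ha hb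
      have h4 := congrArg conj h3
      simp only [conjCoord, sub_apply, smul_apply, smul_eq_mul, map_sub, map_mul, Complex.conj_I,
        ← h1, ← h2, map_zero] at h3 h4
      have h5 : natCoord (3 * k - 1) (2 * σ - 1) Z = 0 := by linear_combination (h3 + h4) / 2
      refine ⟨h5, ?_⟩
      rw [h5] at h3
      simpa using h3
    have hw0' : ∀ τ, 1 ≤ τ → τ ≤ 2 * k - 2 → natCoord (3 * k - 1) τ Z = 0 := by
      intro τ ha hb
      rcases Nat.even_or_odd' τ with ⟨σ, rfl | rfl⟩
      · exact (hw0 σ (by omega) (by omega)).2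
      · have := (hw0 (σ + 1) (by omega) (by omega)).1
        rwa [show 2 * (σ + 1) - 1 = 2 * σ + 1 by omega] at this
    refine hext Z hz0 hw0' ?_ (fun σ ha hb => ?_) hζk0
    · have := hlast.2.1
      rw [hz0, hw0' 1 (by omega) (by omega), hw0' 2 (by omega) (by omega)] at this
      simpa [hz] using this
    · simpa [hz0] using (hσ σ ha hb).2.2.resolve_left hz

end NormalForm

section Singularity

open Filter Topology

lemma ContDiffOn.pairDefect {n : ℕ} {U : Set (EuclideanSpace ℂ (Fin n))}
    {z a b : EuclideanSpace ℂ (Fin n) → ℂ} (hU : IsOpen U) (hz : DifferentiableOn ℂ z U)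
    (ha : DifferentiableOn ℂ a U) (hb : DifferentiableOn ℂ b U) :
    ContDiffOn ℝ (⊤ : ℕ∞) (pairDefect z a b) U := by
  have hz' := (contDiffOn_infty_of_differentiableOn_complex hU hz).restrict_scalars ℝ
  have ha' := (contDiffOn_infty_of_differentiableOn_complex hU ha).restrict_scalars ℝ
  have hb' := (contDiffOn_infty_of_differentiableOn_complex hU hb).restrict_scalars ℝ
  have hc : ContDiffOn ℝ (⊤ : ℕ∞) (fun x => conj (b x)) U :=
    Complex.conjCLE.contDiff.comp_contDiffOn hb'
  exact (contDiffOn_const.add (contDiff_normSq.comp_contDiffOn hz')).mul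
    (contDiff_normSq.comp_contDiffOn (ha'.sub hc))

/-- A generic CR-singularity has a neighbourhood carrying a nonnegative function which vanishes on
the submanifold and is strictly plurisubharmonic away from the singularity. -/
lemma exists_local_strictPshAt_of_isGenericCRSingularity {k : ℕ} {hk : 1 < k}
    {M : Set (EuclideanSpace ℂ (Fin (3 * k - 1)))} {p : EuclideanSpace ℂ (Fin (3 * k - 1))}
    (h : IsGenericCRSingularity k hk M p) :
    ∃ (ρ : EuclideanSpace ℂ (Fin (3 * k - 1)) → ℝ) (U : Set (EuclideanSpace ℂ (Fin (3 * k - 1)))),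
      IsOpen U ∧ p ∈ U ∧ ContDiffOn ℝ (⊤ : ℕ∞) ρ U ∧ (∀ x, 0 ≤ ρ x) ∧ (∀ x ∈ M ∩ U, ρ x = 0) ∧
      ∀ x ∈ U, x ≠ p → StrictPshAt ρ x := by
  obtain ⟨U, V, Φ, Ψ, hU, hV, hpU, h0V, hΦ, hΨ, hmΦ, -, hΨΦ, -, hΦp, himg⟩ := h
  have hz : DifferentiableOn ℂ (fun y => natCoord (3 * k - 1) 0 (Φ y)) U :=
    (natCoord (3 * k - 1) 0).differentiable.comp_differentiableOn hΦ
  have hq : ∀ q ∈ bcPairs k, DifferentiableOn ℂ (fun y => q.1 (Φ y)) U ∧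
      DifferentiableOn ℂ (fun y => q.2 (Φ y)) U := fun q hq =>
    ⟨((contDiff_bcPairs q hq).1.differentiable (by simp)).comp_differentiableOn hΦ,
      ((contDiff_bcPairs q hq).2.differentiable (by simp)).comp_differentiableOn hΦ⟩
  set d : (EuclideanSpace ℂ (Fin (3 * k - 1)) → ℂ) × (EuclideanSpace ℂ (Fin (3 * k - 1)) → ℂ) →
    EuclideanSpace ℂ (Fin (3 * k - 1)) → ℝ := fun q =>
    pairDefect (fun y => natCoord (3 * k - 1) 0 (Φ y)) (fun y => q.1 (Φ y)) (fun y => q.2 (Φ y))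
    with hd
  have hdU : ∀ q ∈ bcPairs k, ContDiffOn ℝ (⊤ : ℕ∞) (d q) U := fun q h =>
    ContDiffOn.pairDefect hU hz (hq q h).1 (hq q h).2
  have hopen : IsOpen (U ∩ (fun y => natCoord (3 * k - 1) 0 (Φ y)) ⁻¹'
      {c | Complex.normSq c < 1 / 3}) :=
    hz.continuousOn.isOpen_inter_preimage hU (isOpen_lt Complex.continuous_normSq continuous_const)
  refine ⟨fun x => ∑ q ∈ bcPairs k, d q x, _, hopen, ⟨hpU, ?_⟩,
    (ContDiffOn.sum hdU).mono Set.inter_subset_left,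
    fun x => Finset.sum_nonneg fun q _ => pairDefect_nonneg _ _ _ x, ?_, ?_⟩
  · rw [Set.mem_preimage, hΦp, map_zero, Set.mem_ofPred_eq, map_zero]
    norm_num
  · rintro x ⟨hxM, hxU, -⟩
    have hx : Φ x ∈ bcForm k hk := (himg.subset ⟨x, ⟨hxM, hxU⟩, rfl⟩).1
    refine Finset.sum_eq_zero fun q hq => ?_
    simp [hd, pairDefect, bcPairs_eq_conj hk hx q hq]
  · rintro x ⟨hxU, hxz⟩ hxp
    have hnhds := hU.eventually_mem hxU
    have hev : ∀ {f : EuclideanSpace ℂ (Fin (3 * k - 1)) → ℂ}, DifferentiableOn ℂ f U →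
        ∀ᶠ y in 𝓝 x, DifferentiableAt ℂ f y := fun hf =>
      hnhds.mono fun y hy => hf.differentiableAt (hU.mem_nhds hy)
    have hΦx : DifferentiableAt ℂ Φ x := hΦ.differentiableAt (hU.mem_nhds hxU)
    refine strictPshAt_sum (fun q h => ((hdU q h).contDiffAt (hU.mem_nhds hxU)).of_le
      (WithTop.coe_le_coe.2 le_top)) (fun q h v => sliceLaplacian_pairDefect_nonneg (hev hz)
        (hev (hq q h).1) (hev (hq q h).2) hxz) fun v hv => ?_
    by_contra! hle
    have hcomp : ∀ f : EuclideanSpace ℂ (Fin (3 * k - 1)) → ℂ, Differentiable ℂ f →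
        fderiv ℂ (fun y => f (Φ y)) x v = fderiv ℂ f (Φ x) (fderiv ℂ Φ x v) := fun f hf => by
      rw [fderiv_fun_comp x hf.differentiableAt hΦx]
      rfl
    have key := eq_zero_of_fderiv_bcPairs_eq_zero hk (Z := Φ x) (W := fderiv ℂ Φ x v) fun q h => by
      have := eq_zero_of_sliceLaplacian_pairDefect_nonpos (hev hz) (hev (hq q h).1)
        (hev (hq q h).2) hxz (hle q h)
      rw [hcomp _ ((contDiff_bcPairs q h).1.differentiable (by simp)),
        hcomp _ ((contDiff_bcPairs q h).2.differentiable (by simp)),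
        hcomp _ (natCoord (3 * k - 1) 0).differentiable,
        (natCoord (3 * k - 1) 0).hasFDerivAt.fderiv] at this
      exact this
    rcases key with hW | hZ
    · have hid : HasFDerivAt (fun y => Ψ (Φ y)) (ContinuousLinearMap.id ℂ _) x :=
        (hasFDerivAt_id x).congr_of_eventuallyEq (hnhds.mono hΨΦ)
      have hΨx : DifferentiableAt ℂ Ψ (Φ x) := hΨ.differentiableAt (hV.mem_nhds (hmΦ hxU))
      have := DFunLike.congr_fun (hid.unique (hΨx.hasFDerivAt.comp x hΦx.hasFDerivAt)) v
      simp only [ContinuousLinearMap.id_apply, ContinuousLinearMap.comp_apply, hW, map_zero] at this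
      exact hv this
    · exact hxp (by rw [← hΨΦ x hxU, ← hΨΦ p hpU, hZ, hΦp])

end Singularity

section Globalization

open Filter Topology

variable {n : ℕ}

/-- Cutting off a nonnegative function by a bump function. -/
lemma exists_contDiff_cutoff {ρ : EuclideanSpace ℂ (Fin n) → ℝ}
    {U : Set (EuclideanSpace ℂ (Fin n))} {p : EuclideanSpace ℂ (Fin n)} (hU : IsOpen U)
    (hp : p ∈ U) (hρ : ContDiffOn ℝ (⊤ : ℕ∞) ρ U) (h0 : ∀ x, 0 ≤ ρ x) :
    ∃ (ψ : EuclideanSpace ℂ (Fin n) → ℝ) (W : Set (EuclideanSpace ℂ (Fin n))),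
      IsOpen W ∧ p ∈ W ∧ W ⊆ U ∧ ContDiff ℝ (⊤ : ℕ∞) ψ ∧ HasCompactSupport ψ ∧ tsupport ψ ⊆ U ∧
      (∀ x, 0 ≤ ψ x) ∧ (∀ x, ρ x = 0 → ψ x = 0) ∧ ∀ x ∈ W, ψ x = ρ x := by
  obtain ⟨r, hr, hrU⟩ := Metric.isOpen_iff.1 hU p hp
  let χ : ContDiffBump p := ⟨r / 4, r / 2, by positivity, by linarith⟩
  have hts : tsupport (fun x => χ x * ρ x) ⊆ tsupport χ :=
    closure_mono (Function.support_mul_subset_left _ _)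
  have hχU : tsupport χ ⊆ U := by
    rw [χ.tsupport_eq]
    exact (Metric.closedBall_subset_ball (by change r / 2 < r; linarith)).trans hrU
  refine ⟨fun x => χ x * ρ x, Metric.ball p (r / 4), Metric.isOpen_ball,
    Metric.mem_ball_self (by positivity), (Metric.ball_subset_ball (by linarith)).trans hrU, ?_,
    χ.hasCompactSupport.mono (Function.support_mul_subset_left _ _), hts.trans hχU,
    fun x => mul_nonneg χ.nonneg (h0 x), fun x hx => by simp [hx], fun x hx => ?_⟩
  · refine contDiff_iff_contDiffAt.2 fun x => ?_
    by_cases hx : x ∈ U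
    · exact χ.contDiff.contDiffAt.mul (hρ.contDiffAt (hU.mem_nhds hx))
    · have : (fun x => χ x * ρ x) =ᶠ[𝓝 x] 0 :=
        notMem_tsupport_iff_eventuallyEq.1 fun h => hx (hχU (hts h))
      exact contDiffAt_const.congr_of_eventuallyEq this
  · have : χ x = 1 := χ.one_of_mem_closedBall (Metric.ball_subset_closedBall hx)
    simp [this]

lemma StrictPshAt.congr {φ ψ : EuclideanSpace ℂ (Fin n) → ℝ} {p : EuclideanSpace ℂ (Fin n)}
    (hφ : StrictPshAt φ p) (h : ψ =ᶠ[𝓝 p] φ) : StrictPshAt ψ p := fun v hv => by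
  rw [sliceLaplacian_congr h]
  exact hφ v hv

/-- Gluing local defining functions of `M`, strictly plurisubharmonic off a finite set `S`, into a
global one. -/
lemma exists_strictPsh_near {M S : Set (EuclideanSpace ℂ (Fin n))} (hM : IsCompact M)
    (hS : S.Finite)
    (hloc : ∀ p ∈ M, ∃ (ρ : EuclideanSpace ℂ (Fin n) → ℝ) (U : Set (EuclideanSpace ℂ (Fin n))),
      IsOpen U ∧ p ∈ U ∧ ContDiffOn ℝ (⊤ : ℕ∞) ρ U ∧ (∀ x, 0 ≤ ρ x) ∧ (∀ x ∈ M ∩ U, ρ x = 0) ∧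
      ∀ x ∈ U, x ∉ S → StrictPshAt ρ x) :
    ∃ (ψ : EuclideanSpace ℂ (Fin n) → ℝ) (N : Set (EuclideanSpace ℂ (Fin n))),
      IsOpen N ∧ M ⊆ N ∧ ContDiff ℝ (⊤ : ℕ∞) ψ ∧ HasCompactSupport ψ ∧ (∀ x, 0 ≤ ψ x) ∧
      (∀ x ∈ M, ψ x = 0) ∧ ∀ x ∈ N, x ∉ S → StrictPshAt ψ x := by
  have hcut : ∀ p : M, ∃ (ψ : EuclideanSpace ℂ (Fin n) → ℝ) (W : Set (EuclideanSpace ℂ (Fin n))),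
      IsOpen W ∧ p.1 ∈ W ∧ ContDiff ℝ (⊤ : ℕ∞) ψ ∧ HasCompactSupport ψ ∧ (∀ x, 0 ≤ ψ x) ∧
      (∀ x ∈ M, ψ x = 0) ∧ (∀ s ∈ S, s ≠ p.1 → s ∉ tsupport ψ ∧ s ∉ W) ∧
      ∀ x ∈ W, x ∉ S → StrictPshAt ψ x := by
    rintro ⟨p, hp⟩
    obtain ⟨ρ, U, hU, hpU, hρ, h0, hρM, hstr⟩ := hloc p hp
    have hT : IsOpen (S \ {p})ᶜ := (hS.subset Set.sdiff_subset).isClosed.isOpen_compl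
    obtain ⟨ψ, W, hW, hpW, hWU, hψ, hcs, hts, hψ0, hψz, hψW⟩ := exists_contDiff_cutoff
      (hU.inter hT) ⟨hpU, fun h => h.2 rfl⟩ (hρ.mono Set.inter_subset_left) h0
    refine ⟨ψ, W, hW, hpW, hψ, hcs, hψ0, fun x hx => ?_, fun s hs hne => ⟨fun h => (hts h).2
      ⟨hs, hne⟩, fun h => (hWU h).2 ⟨hs, hne⟩⟩, fun x hx hxS => ?_⟩
    · by_cases hxU : x ∈ U
      · exact hψz x (hρM x ⟨hx, hxU⟩)
      · exact image_eq_zero_of_notMem_tsupport fun h => hxU (hts h).1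
    · exact (hstr x (hWU hx).1 hxS).congr ((hW.eventually_mem hx).mono hψW)
  choose ψ W hW hpW hψ hcs hψ0 hψM hψS hstr using hcut
  obtain ⟨t, ht⟩ := hM.elim_nhds_subcover' (fun p hp => W ⟨p, hp⟩)
    fun p hp => (hW ⟨p, hp⟩).mem_nhds (hpW ⟨p, hp⟩)
  have hψ2 : ∀ i, ContDiff ℝ 2 (ψ i) := fun i => (hψ i).of_le (WithTop.coe_le_coe.2 le_top)
  have hsum : ContDiff ℝ (⊤ : ℕ∞) (fun x => ∑ i ∈ t, ψ i x) := ContDiff.sum fun i _ => hψ i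
  have hopen := isOpen_setOf_strictPshAt (hsum.of_le (m := 2) (WithTop.coe_le_coe.2 le_top))
  have hcover : ∀ p ∈ M, ∃ i ∈ t, p ∈ W i := fun p hp => by simpa using ht hp
  refine ⟨fun x => ∑ i ∈ t, ψ i x, interior {x | x ∉ S → StrictPshAt (fun x => ∑ i ∈ t, ψ i x) x},
    isOpen_interior, fun p hp => ?_, hsum, ?_, fun x => Finset.sum_nonneg fun i _ => hψ0 i x,
    fun x hx => Finset.sum_eq_zero fun i _ => hψM i x hx, fun x hx => ?_⟩
  · obtain ⟨i, hi, hpi⟩ := hcover p hp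
    rw [mem_interior_iff_mem_nhds]
    by_cases hpS : p ∈ S
    · have hip : p = i.1 := by
        by_contra hne
        exact (hψS i p hpS hne).2 hpi
      have hO : ∀ᶠ x in 𝓝 p, x ∈ W i ∧ ∀ j ∈ t, j ≠ i → ∀ᶠ y in 𝓝 x, ψ j y = 0 := by
        refine ((hW i).eventually_mem hpi).and ((Finset.eventually_all t).2 fun j _ => ?_)
        by_cases hji : j = i
        · simp [hji]
        · have hpj : p ∉ tsupport (ψ j) :=
            (hψS j p hpS fun h => hji (Subtype.ext (h.symm.trans hip))).1
          exact (notMem_tsupport_iff_eventuallyEq.1 hpj).eventually_nhds.mono fun x hx _ => hx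
      filter_upwards [hO] with x hx hxS
      refine (hstr i x hx.1 hxS).congr ?_
      have : ∀ᶠ y in 𝓝 x, ∀ j ∈ t, j ≠ i → ψ j y = 0 := (Finset.eventually_all t).2 fun j hj => by
        by_cases hji : j = i
        · simp [hji]
        · exact (hx.2 j hj hji).mono fun y hy _ => hy
      exact this.mono fun y hy => Finset.sum_eq_single_of_mem i hi hy
    · have : StrictPshAt (fun x => ∑ i ∈ t, ψ i x) p :=
        strictPshAt_sum (fun j _ => (hψ2 j).contDiffAt) (fun j _ v =>
          sliceLaplacian_nonneg_of_isLocalMin (hψ2 j).contDiffAt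
            (Eventually.of_forall fun x => by rw [hψM j p hp]; exact hψ0 j x) v)
          fun v hv => ⟨i, hi, hstr i p hpi hpS v hv⟩
      filter_upwards [hopen.mem_nhds this] with x hx _ using hx
  · refine HasCompactSupport.intro (t.isCompact_biUnion fun i _ => hcs i) fun x hx => ?_
    refine Finset.sum_eq_zero fun i hi => image_eq_zero_of_notMem_tsupport fun h => hx ?_
    exact Set.mem_biUnion hi h
  · exact interior_subset hx

/-- A rationally convex compact set with a local strictly plurisubharmonic defining function off a
finite set `S` is null for the complex Hessian, tangentially, of a global one. -/
lemma exists_isotropic_psh {M S : Set (EuclideanSpace ℂ (Fin n))} (hM : IsCompact M)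
    (hne : M.Nonempty) (hSM : S ⊆ M) (hrc : ratHull M = M)
    {ψ : EuclideanSpace ℂ (Fin n) → ℝ} {N : Set (EuclideanSpace ℂ (Fin n))} (hN : IsOpen N)
    (hMN : M ⊆ N) (hψ : ContDiff ℝ (⊤ : ℕ∞) ψ) (hcs : HasCompactSupport ψ) (hψ0 : ∀ x, 0 ≤ ψ x)
    (hψM : ∀ x ∈ M, ψ x = 0) (hstr : ∀ x ∈ N, x ∉ S → StrictPshAt ψ x) :
    ∃ φ : EuclideanSpace ℂ (Fin n) → ℝ,
      ContDiff ℝ (⊤ : ℕ∞) φ ∧ PshOn φ Set.univ ∧ StrictPshOn φ (Set.univ \ S) ∧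
      ∀ p ∈ M, ∀ u ∈ tangentSpaceAt M p, ∀ v ∈ tangentSpaceAt M p,
        iteratedFDeriv ℝ 2 φ p ![u, Complex.I • v]
          - iteratedFDeriv ℝ 2 φ p ![v, Complex.I • u] = 0 := by
  obtain ⟨R, hR, hRM⟩ := (hM.union hcs.isCompact).isBounded.subset_closedBall_lt 0 0
  have hK : IsCompact (Metric.closedBall (0 : EuclideanSpace ℂ (Fin n)) R \ N) :=
    (isCompact_closedBall 0 R).diff hN
  obtain ⟨φ₁, h₁, hs₁⟩ := exists_isPshFlatOn_strictPshOn hM hne hK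
    (by rw [hrc]; exact Set.disjoint_left.2 fun x hx hxM => hx.2 (hMN hxM))
  obtain ⟨φ₂, h₂, hs₂⟩ := exists_isPshFlatOn_closedBall n R hR
  have hψ2 : ContDiff ℝ 2 ψ := hψ.of_le (WithTop.coe_le_coe.2 le_top)
  obtain ⟨C, hC, hsC⟩ := exists_strictPshOn_const_mul_add hK h₁.contDiff_two hψ2 hs₁
  have h1C : ContDiff ℝ 2 (fun x => C * φ₁ x) := contDiff_const.mul h₁.contDiff_two
  have hlap : ∀ x v, sliceLaplacian (fun x => C * φ₁ x + ψ x + φ₂ x) x v =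
      C * sliceLaplacian φ₁ x v + sliceLaplacian ψ x v + sliceLaplacian φ₂ x v := fun x v => by
    rw [sliceLaplacian_add (h1C.add hψ2).contDiffAt h₂.contDiff_two.contDiffAt,
      sliceLaplacian_add h1C.contDiffAt hψ2.contDiffAt,
      sliceLaplacian_const_mul C h₁.contDiff_two.contDiffAt]
  have hstrict : StrictPshOn (fun x => C * φ₁ x + ψ x + φ₂ x) (Set.univ \ S) := by
    rintro x ⟨-, hxS⟩ v hv
    rw [hlap]
    have h1 := mul_nonneg hC.le (h₁.nonneg x v)
    have h2 := h₂.nonneg x v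
    by_cases hxN : x ∈ N
    · have := hstr x hxN hxS v hv
      linarith
    by_cases hxR : x ∈ Metric.closedBall 0 R
    · have := hsC x ⟨hxR, hxN⟩ v hv
      rw [sliceLaplacian_add h1C.contDiffAt hψ2.contDiffAt,
        sliceLaplacian_const_mul C h₁.contDiff_two.contDiffAt] at this
      linarith
    · have h3 := hs₂ x (by simpa using hxR) v hv
      have hzero : ψ =ᶠ[𝓝 x] 0 :=
        notMem_tsupport_iff_eventuallyEq.1 fun h => hxR (hRM (Or.inr h))
      have h4 : 0 ≤ sliceLaplacian ψ x v := sliceLaplacian_nonneg_of_isLocalMin hψ2.contDiffAt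
        (Eventually.of_forall fun y => by rw [hzero.self_of_nhds]; exact hψ0 y) v
      linarith
  refine ⟨fun x => C * φ₁ x + ψ x + φ₂ x, ((contDiff_const.mul h₁.contDiff).add hψ).add h₂.contDiff,
    fun x _ v => ?_, hstrict, fun p hp u hu v hv => ?_⟩
  · by_cases hxS : x ∈ S
    · rw [hlap]
      have h1 := mul_nonneg hC.le (h₁.nonneg x v)
      have h2 := h₂.nonneg x v
      have h3 : 0 ≤ sliceLaplacian ψ x v := sliceLaplacian_nonneg_of_isLocalMin hψ2.contDiffAt
        (Eventually.of_forall fun y => by rw [hψM x (hSM hxS)]; exact hψ0 y) v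
      linarith
    · rcases eq_or_ne v 0 with rfl | hv
      · simp [sliceLaplacian, iteratedFDeriv_two_apply]
      · exact (hstrict x ⟨trivial, hxS⟩ v hv).le
  · have hflat : ∀ v, sliceLaplacian (fun x => C * φ₁ x + φ₂ x) p v = 0 := fun v => by
      rw [sliceLaplacian_add h1C.contDiffAt h₂.contDiff_two.contDiffAt,
        sliceLaplacian_const_mul C h₁.contDiff_two.contDiffAt, h₁.flat p hp,
        h₂.flat p (hRM (Or.inl hp))]
      simp
    have h12 : ContDiff ℝ 2 (fun x => C * φ₁ x + φ₂ x) := h1C.add h₂.contDiff_two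
    have hsplit : fderiv ℝ (fderiv ℝ fun x => C * φ₁ x + ψ x + φ₂ x) p =
        fderiv ℝ (fderiv ℝ fun x => C * φ₁ x + φ₂ x) p + fderiv ℝ (fderiv ℝ ψ) p := by
      have h1 : (fderiv ℝ fun x => C * φ₁ x + ψ x + φ₂ x) =
          fun x => fderiv ℝ (fun x => C * φ₁ x + φ₂ x) x + fderiv ℝ ψ x := by
        funext x
        rw [← fderiv_fun_add (h12.differentiable (by simp) x) (hψ2.differentiable (by simp) x)]
        congr 1
        funext y
        ring
      rw [h1, fderiv_fun_add]
      · exact (h12.fderiv_right (m := 1) (by norm_num)).differentiable (by simp) p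
      · exact (hψ2.fderiv_right (m := 1) (by norm_num)).differentiable (by simp) p
    have := isotropic_of_sliceLaplacian_eq_zero h12.contDiffAt hflat u v
    simp only [iteratedFDeriv_two_apply, hsplit, add_apply, Matrix.cons_val_zero,
      Matrix.cons_val_one, fderiv_fderiv_eq_zero_of_mem_tangentSpaceAt hψ2 hψ0 hψM hp hu,
      fderiv_fderiv_eq_zero_of_mem_tangentSpaceAt hψ2 hψ0 hψM hp hv, add_zero]
    exact this

end Globalization

/-- **Theorem 1.4 (2).** Let `M ⊆ ℂ^{3k-1}` (`k > 1`) be a `2k`-dimensional smooth compact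
connected submanifold that is totally real except on a finite set `S` of generic
CR-singularities. If `M` is rationally convex, then `M` is isotropic with respect to
`dd^c φ` for some smooth function `φ` that is p.s.h. on `ℂ^{3k-1}` and strictly p.s.h. on
`ℂ^{3k-1} \ S`; isotropy is expressed as `D²φ(p)(u, iv) - D²φ(p)(v, iu) = 0` for all
`p ∈ M` and `u, v ∈ T_pM`. -/
theorem isotropic_of_rationally_convex
    (k : ℕ) (hk : 1 < k)
    (M S : Set (EuclideanSpace ℂ (Fin (3*k-1))))
    (hsub : IsSubmanifold (2*k) (by omega) M)
    (hcpt : IsCompact M) (hconn : IsConnected M)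
    (hS : S.Finite) (hSM : S ⊆ M)
    (htr : ∀ p ∈ M \ S, TotallyRealAt M p)
    (hcr : ∀ p ∈ S, IsGenericCRSingularity k hk M p)
    (hrc : ratHull M = M) :
    ∃ φ : EuclideanSpace ℂ (Fin (3*k-1)) → ℝ,
      ContDiff ℝ (⊤ : ℕ∞) φ ∧ PshOn φ Set.univ ∧ StrictPshOn φ (Set.univ \ S) ∧
      ∀ p ∈ M, ∀ u ∈ tangentSpaceAt M p, ∀ v ∈ tangentSpaceAt M p,
        iteratedFDeriv ℝ 2 φ p ![u, Complex.I • v]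
          - iteratedFDeriv ℝ 2 φ p ![v, Complex.I • u] = 0 := by
  have hloc : ∀ p ∈ M, ∃ (ρ : EuclideanSpace ℂ (Fin (3 * k - 1)) → ℝ)
      (U : Set (EuclideanSpace ℂ (Fin (3 * k - 1)))), IsOpen U ∧ p ∈ U ∧
      ContDiffOn ℝ (⊤ : ℕ∞) ρ U ∧ (∀ x, 0 ≤ ρ x) ∧ (∀ x ∈ M ∩ U, ρ x = 0) ∧
      ∀ x ∈ U, x ∉ S → StrictPshAt ρ x := by
    intro p hp
    by_cases hpS : p ∈ S
    · obtain ⟨ρ, U, hU, hpU, hρ, h0, hρM, hstr⟩ :=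
        exists_local_strictPshAt_of_isGenericCRSingularity (hcr p hpS)
      exact ⟨ρ, U, hU, hpU, hρ, h0, hρM, fun x hx hxS => hstr x hx fun h => hxS (h ▸ hpS)⟩
    · obtain ⟨ρ, U, hU, hpU, hρ, h0, hρM, hstr⟩ :=
        exists_local_strictPshAt_of_totallyRealAt hsub hp (htr p ⟨hp, hpS⟩)
      obtain ⟨ψ, W, hW, hpW, hWU, hψ, -, -, hψ0, hψz, hψW⟩ := exists_contDiff_cutoff hU hpU hρ h0
      have hψp : StrictPshAt ψ p :=
        hstr.congr (Filter.eventually_of_mem (hW.mem_nhds hpW) hψW)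
      have hopen := isOpen_setOf_strictPshAt (hψ.of_le (m := 2) (WithTop.coe_le_coe.2 le_top))
      exact ⟨ψ, W ∩ {x | StrictPshAt ψ x}, hW.inter hopen, ⟨hpW, hψp⟩, hψ.contDiffOn, hψ0,
        fun x hx => hψz x (hρM x ⟨hx.1, hWU hx.2.1⟩), fun x hx _ => hx.2⟩
  obtain ⟨ψ, N, hN, hMN, hψ, hcs, hψ0, hψM, hstr⟩ := exists_strictPsh_near hcpt hS hloc
  exact exists_isotropic_psh hcpt hconn.nonempty hSM hrc hN hMN hψ hcs hψ0 hψM hstr
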